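/- Let Y ⊂ ℙ^r be an integral and non-degenerate variety of dimension n over an algebraically closed field (of arbitrary characteristic), and assume Y is not very strange. Fix a general finite subset S ⊂ Y with #S ≤ r − n − 1. Then S is the set-theoretic base locus of the linear system on Y induced by H^0(ℙ^r, I_S(1)), i.e., the only points of Y lying on every hyperplane of ℙ^r containing S are the points of S. -/

import Mathlib

noncomputable section

namespace ContactLoci

variable {K : Type*} [Field K] {ι : Type*} [Fintype ι]

/-- Projective space over `K` with homogeneous coordinates indexed by `ι`. -/
abbrev PP (K : Type*) [Field K] (ι : Type*) : Type _ :=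
  Projectivization K (ι → K)

/-- The affine cone over a set of projective points. -/
def coneOf (S : Set (PP K ι)) : Set (ι → K) :=
  ⋃ x ∈ S, (x.submodule : Set (ι → K))

/-- The linear span, in the underlying vector space, of the cone over `S`. -/
def vspan (S : Set (PP K ι)) : Submodule K (ι → K) :=
  Submodule.span K (coneOf S)

/-- The projective linear span of a set of projective points. -/
def projSpan (S : Set (PP K ι)) : Set (PP K ι) :=
  {x | x.submodule ≤ vspan S}

/-- The projective dimension of the linear span of `S` (`-1` for `S = ∅`). -/
def projDim (S : Set (PP K ι)) : ℤ :=
  (Module.finrank K (vspan S) : ℤ) - 1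

/-- A set of projective points is non-degenerate if its linear span is everything. -/
def Nondegenerate (S : Set (PP K ι)) : Prop :=
  vspan S = ⊤

/-- The common zero locus in projective space of a set of polynomials. -/
def zeroLocus (S : Set (MvPolynomial ι K)) : Set (PP K ι) :=
  {x | ∀ f ∈ S, ∀ v ∈ x.submodule, MvPolynomial.eval v f = 0}

/-- Zariski-closed subsets of projective space: common zero loci of sets of
homogeneous polynomials. -/
def IsZClosed (X : Set (PP K ι)) : Prop :=
  ∃ S : Set (MvPolynomial ι K), (∀ f ∈ S, ∃ d : ℕ, f.IsHomogeneous d) ∧ X = zeroLocus S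

/-- Zariski closure. -/
def zclosure (S : Set (PP K ι)) : Set (PP K ι) :=
  ⋂₀ {Y | IsZClosed Y ∧ S ⊆ Y}

/-- Irreducibility with respect to the Zariski topology. -/
def IsZIrreducible (S : Set (PP K ι)) : Prop :=
  S.Nonempty ∧ ∀ Y Z : Set (PP K ι), IsZClosed Y → IsZClosed Z → S ⊆ Y ∪ Z → S ⊆ Y ∨ S ⊆ Z

/-- An integral projective variety: a Zariski-closed irreducible subset. -/
def IsIntegralVariety (X : Set (PP K ι)) : Prop :=
  IsZClosed X ∧ IsZIrreducible X

/-- `C` is an irreducible component of `S`: a maximal irreducible subset of `S`. -/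
def IsZIrredComponent (S C : Set (PP K ι)) : Prop :=
  IsZIrreducible C ∧ C ⊆ S ∧ ∀ D : Set (PP K ι), IsZIrreducible D → D ⊆ S → C ⊆ D → C = D

/-- The dimension of a set: the Krull dimension of the poset of irreducible
Zariski-closed subsets of its Zariski closure (`⊥` for the empty set). -/
def zdim (S : Set (PP K ι)) : WithBot ℕ∞ :=
  Order.krullDim ({Y : Set (PP K ι) // IsZClosed Y ∧ IsZIrreducible Y ∧ Y ⊆ zclosure S})

/-- A property holds at a general point of `X`: it holds away from a proper
Zariski-closed subset. -/
def HoldsGenerically (X : Set (PP K ι)) (P : PP K ι → Prop) : Prop :=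
  ∃ Y : Set (PP K ι), IsZClosed Y ∧ ¬X ⊆ Y ∧ ∀ x ∈ X \ Y, P x

/-- Zero locus of multihomogeneous polynomials in a self-product of projective space. -/
def multiZeroLocus {m : ℕ} (S : Set (MvPolynomial (Fin m × ι) K)) :
    Set (Fin m → PP K ι) :=
  {u | ∀ f ∈ S, ∀ v : Fin m → ι → K, (∀ i, v i ∈ (u i).submodule) →
    MvPolynomial.eval (fun p => v p.1 p.2) f = 0}

/-- Zariski-closed subsets of the `m`-fold self-product of projective space. -/
def IsMultiZClosed {m : ℕ} (T : Set (Fin m → PP K ι)) : Prop :=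
  ∃ S : Set (MvPolynomial (Fin m × ι) K),
    (∀ f ∈ S, ∀ i : Fin m, ∃ d : ℕ,
      MvPolynomial.IsWeightedHomogeneous (fun p : Fin m × ι => if p.1 = i then 1 else 0) f d) ∧
    T = multiZeroLocus S

/-- A property holds for a general `m`-tuple of points of `X`. -/
def HoldsForGeneralTuples (X : Set (PP K ι)) (m : ℕ) (P : (Fin m → PP K ι) → Prop) : Prop :=
  ∃ T : Set (Fin m → PP K ι), IsMultiZClosed T ∧
    (∃ u : Fin m → PP K ι, (∀ i, u i ∈ X) ∧ u ∉ T) ∧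
    ∀ u : Fin m → PP K ι, (∀ i, u i ∈ X) → u ∉ T → P u

/-- The homogeneous vanishing ideal of `X` (as a set of homogeneous polynomials). -/
def homogVanishingIdeal (X : Set (PP K ι)) : Set (MvPolynomial ι K) :=
  {f | (∃ d : ℕ, f.IsHomogeneous d) ∧ ∀ x ∈ X, ∀ v ∈ x.submodule, MvPolynomial.eval v f = 0}

/-- The embedded (projective) tangent space of `X` at `x`. -/
def embTangentSpace (X : Set (PP K ι)) (x : PP K ι) : Set (PP K ι) :=
  {y | ∀ f ∈ homogVanishingIdeal X,
    ∑ i : ι, y.rep i * MvPolynomial.eval x.rep (MvPolynomial.pderiv i f) = 0}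

/-- Smooth points of `X`. -/
def IsSmoothPoint (X : Set (PP K ι)) (x : PP K ι) : Prop :=
  x ∈ X ∧ zdim (embTangentSpace X x) = zdim X

/-- `M_A`: the linear span of the tangent spaces of `X` at the points of `A`. -/
def tangentSpan (X A : Set (PP K ι)) : Set (PP K ι) :=
  projSpan (⋃ a ∈ A, embTangentSpace X a)

/-- The locus of smooth points of `X` at which `M_A` is tangent to `X`. -/
def tangencyLocus (X A : Set (PP K ι)) : Set (PP K ι) :=
  {x | IsSmoothPoint X x ∧ embTangentSpace X x ⊆ tangentSpan X A}

/-- The tangential contact locus of `X` at `A`: the closure of the union of the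
irreducible components of the tangency locus meeting `A`. -/
def contactLocus (X A : Set (PP K ι)) : Set (PP K ι) :=
  zclosure (⋃ C ∈ {C : Set (PP K ι) |
    IsZIrredComponent (tangencyLocus X A) C ∧ (C ∩ A).Nonempty}, C)

/-- `X` is weakly `k`-defective: the tangential contact locus at `k` general points
has positive dimension. -/
def WeaklyDefective (X : Set (PP K ι)) (k : ℕ) : Prop :=
  HoldsForGeneralTuples X k fun u => 0 < zdim (contactLocus X (Set.range u))

/-- The `k`-th secant variety of `X`. -/
def secant (k : ℕ) (X : Set (PP K ι)) : Set (PP K ι) :=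
  zclosure {q | ∃ S : Finset (PP K ι), ↑S ⊆ X ∧ S.card = k ∧ q ∈ projSpan (S : Set (PP K ι))}

/-- The `X`-rank of a point. -/
def xrank (X : Set (PP K ι)) (q : PP K ι) : ℕ :=
  sInf {k | ∃ S : Finset (PP K ι), ↑S ⊆ X ∧ S.card = k ∧ q ∈ projSpan (S : Set (PP K ι))}

/-- `𝒮(q,X)`: the set of minimal `X`-decompositions of `q`. -/
def decompositions (X : Set (PP K ι)) (q : PP K ι) : Set (Finset (PP K ι)) :=
  {S | ↑S ⊆ X ∧ S.card = xrank X q ∧ q ∈ projSpan (S : Set (PP K ι))}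

/-- `X` is `k`-identifiable: a general point of `σ_k(X)` has a unique minimal
decomposition. -/
def Identifiable (X : Set (PP K ι)) (k : ℕ) : Prop :=
  HoldsGenerically (secant k X) fun q => ∃! S : Finset (PP K ι), S ∈ decompositions X q

/-- `α` is the `k`-th secant degree of `X`. -/
def HasSecantDegree (X : Set (PP K ι)) (k α : ℕ) : Prop :=
  HoldsGenerically (secant k X) fun q => (decompositions X q).ncard = α

/-- Projective linear subspaces. -/
def IsProjLinear (L : Set (PP K ι)) : Prop :=
  L = projSpan L

/-- Lines in projective space. -/
def IsLine (L : Set (PP K ι)) : Prop :=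
  IsProjLinear L ∧ Module.finrank K (vspan L) = 2

/-- `X` is uniruled by lines: through a general point of `X` there is a line
contained in `X`. -/
def UniruledByLines (X : Set (PP K ι)) : Prop :=
  HoldsGenerically X fun x => ∃ L : Set (PP K ι), IsLine L ∧ x ∈ L ∧ L ⊆ X

/-- The join of two sets in projective space. -/
def join (A B : Set (PP K ι)) : Set (PP K ι) :=
  zclosure (⋃ a ∈ A, ⋃ b ∈ B, projSpan {a, b})

/-- The linear space `M` is tangent to `X` along `W`. -/
def TangentAlong (M X W : Set (PP K ι)) : Prop :=
  ∀ x ∈ W, IsSmoothPoint X x → embTangentSpace X x ⊆ M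

/-- `S` has exactly `m` irreducible components, all of them projective linear
subspaces, and these components are linearly independent. -/
def ComponentsAreIndepLinear (S : Set (PP K ι)) (m : ℕ) : Prop :=
  ∃ C : Fin m → Set (PP K ι), Function.Injective C ∧
    (∀ D : Set (PP K ι), IsZIrredComponent S D ↔ ∃ i, D = C i) ∧
    (∀ i, IsProjLinear (C i)) ∧
    Module.finrank K (vspan S) = ∑ i, Module.finrank K (vspan (C i))


/-- The Segre variety: the image of `ℙ^{n 1} × ⋯ × ℙ^{n s}` under the Segre
embedding, given by the complete linear system `|O(1,…,1)|`. -/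
def segreVariety (K : Type*) [Field K] (s : ℕ) (n : Fin s → ℕ) :
    Set (PP K (∀ i : Fin s, Fin (n i + 1))) :=
  {x | ∃ u : ∀ i : Fin s, Fin (n i + 1) → K,
    x.submodule = Submodule.span K
      ({fun t => ∏ i, u i (t i)} : Set ((∀ i : Fin s, Fin (n i + 1)) → K))}

/-- The projection of `L ⊆ Segre` to the `i`-th factor is a single point, i.e. `L`
lies in a single fiber of the `i`-th projection. -/
def SegreFactorIsPoint (K : Type*) [Field K] (s : ℕ) (n : Fin s → ℕ) (i : Fin s)
    (L : Set (PP K (∀ j : Fin s, Fin (n j + 1)))) : Prop :=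
  ∃ w : Fin (n i + 1) → K, w ≠ 0 ∧ ∀ x ∈ L,
    ∃ u : ∀ j : Fin s, Fin (n j + 1) → K,
      x.submodule = Submodule.span K
        ({fun t => ∏ j, u j (t j)} : Set ((∀ j : Fin s, Fin (n j + 1)) → K)) ∧
      u i ∈ Submodule.span K ({w} : Set (Fin (n i + 1) → K))

/-- Index type for the Segre–Veronese embedding of multidegree `d`:
multi-indices of degree `d i` in the homogeneous variables of the `i`-th factor. -/
abbrev svIndex (s : ℕ) (n d : Fin s → ℕ) : Type :=
  ∀ i : Fin s, {w : Fin (n i + 1) → Fin (d i + 1) // ∑ j, (w j : ℕ) = d i}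

/-- The Segre–Veronese variety of multidegree `d`: the image of
`ℙ^{n 1} × ⋯ × ℙ^{n s}` under the embedding by `|L_1^{d 1} ⊗ ⋯ ⊗ L_s^{d s}|`. -/
def segreVeroneseVariety (K : Type*) [Field K] (s : ℕ) (n d : Fin s → ℕ) :
    Set (PP K (svIndex s n d)) :=
  {x | ∃ u : ∀ i : Fin s, Fin (n i + 1) → K,
    x.submodule = Submodule.span K
      ({fun t => ∏ i, ∏ j, u i j ^ ((t i).1 j : ℕ)} : Set (svIndex s n d → K))}

/-- The vector of the moments of degree `≤ d` of the one-dimensional Gaussian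
distribution with mean `μ` and variance `t`. -/
def gaussMomentVec (K : Type*) [Field K] (d : ℕ) (μ t : K) : Fin (d + 1) → K := fun i =>
  ∑ j ∈ Finset.range ((i : ℕ) / 2 + 1),
    ((Nat.choose (i : ℕ) (2 * j) * Nat.doubleFactorial (2 * j - 1) : ℕ) : K) *
      t ^ j * μ ^ ((i : ℕ) - 2 * j)

/-- The Gaussian moment variety `𝒢_{1,d} ⊆ ℙ^d`. -/
def gaussianMomentVariety (K : Type*) [Field K] (d : ℕ) : Set (PP K (Fin (d + 1))) :=
  zclosure {x | ∃ μ t : K,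
    x.submodule = Submodule.span K ({gaussMomentVec K d μ t} : Set (Fin (d + 1) → K))}

/-- Zariski-closed families of `m`-tuples of coefficient vectors of linear forms. -/
def IsAffineClosedFamily {m : ℕ} (T : Set (Fin m → ι → K)) : Prop :=
  ∃ S : Set (MvPolynomial (Fin m × ι) K),
    T = {h | ∀ f ∈ S, MvPolynomial.eval (fun p => h p.1 p.2) f = 0}

/-- The linear subspace cut out by the `m` linear forms with coefficient vectors `h`. -/
def linearSlice {m : ℕ} (h : Fin m → ι → K) : Set (PP K ι) :=
  {x | ∀ j : Fin m, ∑ i : ι, h j i * x.rep i = 0}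

/-- `x` lies on the hyperplane with coefficient vector `f`. -/
def inHyperplane (f : ι → K) (x : PP K ι) : Prop :=
  ∑ i : ι, f i * x.rep i = 0

/-- `X ⊆ ℙ^r` (of dimension `n`, `r + 1 = card ι`) is very strange: for a general
codimension-`n` linear subspace `M`, some `r - n + 2` points of `X ∩ M` lie in a
hyperplane of `M`, i.e. in a linear subspace of projective dimension `r - n - 1`. -/
def VeryStrange (n : ℕ) (X : Set (PP K ι)) : Prop :=
  ∃ T : Set (Fin n → ι → K), IsAffineClosedFamily T ∧ (∃ h, h ∉ T) ∧
    ∀ h : Fin n → ι → K, h ∉ T →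
      ∃ A : Finset (PP K ι), ↑A ⊆ X ∩ linearSlice h ∧
        A.card = Fintype.card ι + 1 - n ∧
        Module.finrank K (vspan (A : Set (PP K ι))) ≤ Fintype.card ι - 1 - n


/-! ### Auxiliary material -/

/-- polynomial functions -/
def IsPolyFn {K : Type*} [Field K] {σ : Type*} (f : (σ → K) → K) : Prop :=
  ∃ p : MvPolynomial σ K, ∀ x, MvPolynomial.eval x p = f x

lemma isPolyFn_eval {K : Type*} [Field K] {σ : Type*} (p : MvPolynomial σ K) :
    IsPolyFn (fun x => MvPolynomial.eval x p) := ⟨p, fun _ => rfl⟩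

lemma isPolyFn_const {K : Type*} [Field K] {σ : Type*} (a : K) :
    IsPolyFn (fun _ : σ → K => a) := ⟨MvPolynomial.C a, fun _ => by simp⟩

lemma isPolyFn_apply {K : Type*} [Field K] {σ : Type*} (s : σ) :
    IsPolyFn (fun x : σ → K => x s) := ⟨MvPolynomial.X s, fun _ => by simp⟩

lemma IsPolyFn.add {K : Type*} [Field K] {σ : Type*} {f g : (σ → K) → K}
    (hf : IsPolyFn f) (hg : IsPolyFn g) : IsPolyFn (fun x => f x + g x) := by
  obtain ⟨p, hp⟩ := hf
  obtain ⟨q, hq⟩ := hg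
  exact ⟨p + q, fun x => by simp [hp, hq]⟩

lemma IsPolyFn.mul {K : Type*} [Field K] {σ : Type*} {f g : (σ → K) → K}
    (hf : IsPolyFn f) (hg : IsPolyFn g) : IsPolyFn (fun x => f x * g x) := by
  obtain ⟨p, hp⟩ := hf
  obtain ⟨q, hq⟩ := hg
  exact ⟨p * q, fun x => by simp [hp, hq]⟩

lemma IsPolyFn.sum {K : Type*} [Field K] {σ α : Type*} (t : Finset α) {f : α → (σ → K) → K}
    (hf : ∀ a, IsPolyFn (f a)) : IsPolyFn (fun x => ∑ a ∈ t, f a x) := by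
  choose p hp using hf
  exact ⟨∑ a ∈ t, p a, fun x => by simp [hp]⟩

lemma IsPolyFn.prod {K : Type*} [Field K] {σ α : Type*} (t : Finset α) {f : α → (σ → K) → K}
    (hf : ∀ a, IsPolyFn (f a)) : IsPolyFn (fun x => ∏ a ∈ t, f a x) := by
  choose p hp using hf
  exact ⟨∏ a ∈ t, p a, fun x => by simp [hp]⟩

lemma IsPolyFn.comp {K : Type*} [Field K] {σ τ : Type*} {f : (σ → K) → K} (hf : IsPolyFn f)
    {φ : σ → (τ → K) → K} (hφ : ∀ s, IsPolyFn (φ s)) :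
    IsPolyFn (fun x => f (fun s => φ s x)) := by
  obtain ⟨p, hp⟩ := hf
  choose q hq using hφ
  refine ⟨MvPolynomial.bind₁ q p, fun x => ?_⟩
  show _ = f _
  rw [← hp, ← MvPolynomial.coe_aeval_eq_eval, ← MvPolynomial.coe_aeval_eq_eval]
  simp only [RingHom.coe_coe, MvPolynomial.aeval_bind₁]
  congr 2
  funext s
  simpa using hq s x

lemma IsPolyFn.det {K : Type*} [Field K] {σ κ : Type*} [Fintype κ] [DecidableEq κ]
    {M : (σ → K) → Matrix κ κ K} (hM : ∀ i j, IsPolyFn (fun x => M x i j)) :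
    IsPolyFn (fun x => (M x).det) := by
  simp only [Matrix.det_apply']
  exact IsPolyFn.sum _ fun s => (isPolyFn_const _).mul (IsPolyFn.prod _ fun i => hM _ _)

lemma IsPolyFn.adjugate {K : Type*} [Field K] {σ κ : Type*} [Fintype κ] [DecidableEq κ]
    {M : (σ → K) → Matrix κ κ K} (hM : ∀ i j, IsPolyFn (fun x => M x i j)) (i j : κ) :
    IsPolyFn (fun x => (M x).adjugate i j) := by
  simp only [Matrix.adjugate_apply]
  refine IsPolyFn.det fun a b => ?_
  simp only [Matrix.updateRow_apply]
  split_ifs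
  · exact isPolyFn_const _
  · exact hM _ _

/-- irreducible sets of points in affine space -/
def Irr {K : Type*} [Field K] {σ : Type*} (X : Set (σ → K)) : Prop :=
  X.Nonempty ∧ ∀ f g : (σ → K) → K, IsPolyFn f → IsPolyFn g →
    (∃ x ∈ X, f x ≠ 0) → (∃ x ∈ X, g x ≠ 0) → ∃ x ∈ X, f x ≠ 0 ∧ g x ≠ 0

lemma irr_univ {K : Type*} [Field K] [Infinite K] {σ : Type*} : Irr (Set.univ : Set (σ → K)) := by
  refine ⟨⟨0, trivial⟩, ?_⟩
  rintro f g ⟨p, hp⟩ ⟨q, hq⟩ ⟨x, -, hx⟩ ⟨y, -, hy⟩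
  have hpq : p * q ≠ 0 := by
    refine mul_ne_zero ?_ ?_
    · rintro rfl
      exact hx (by simp [← hp])
    · rintro rfl
      exact hy (by simp [← hq])
  by_contra hcon
  push Not at hcon
  refine hpq (MvPolynomial.funext fun z => ?_)
  by_cases hz : f z = 0
  · simp [hp, hz]
  · simp [hq, hcon z trivial hz]

/-- polynomial functions of tuples of vectors -/
def IsPolyFn2 {K : Type*} [Field K] {κ σ : Type*} (f : (κ → σ → K) → K) : Prop :=
  IsPolyFn (fun z : κ × σ → K => f (fun i s => z (i, s)))

lemma isPolyFn2_eval {K : Type*} [Field K] {κ σ : Type*} (p : MvPolynomial (κ × σ) K) :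
    IsPolyFn2 (fun x : κ → σ → K => MvPolynomial.eval (fun q => x q.1 q.2) p) :=
  isPolyFn_eval p

lemma IsPolyFn2.mul {K : Type*} [Field K] {κ σ : Type*} {f g : (κ → σ → K) → K}
    (hf : IsPolyFn2 f) (hg : IsPolyFn2 g) : IsPolyFn2 (fun x => f x * g x) :=
  IsPolyFn.mul hf hg

lemma IsPolyFn2.comp {K : Type*} [Field K] {κ σ τ : Type*} {f : (κ → σ → K) → K}
    (hf : IsPolyFn2 f) {φ : (τ → K) → κ → σ → K} (hφ : ∀ i s, IsPolyFn (fun x => φ x i s)) :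
    IsPolyFn (fun x => f (φ x)) :=
  IsPolyFn.comp (φ := fun (q : κ × σ) x => φ x q.1 q.2) hf (fun q => hφ q.1 q.2)

lemma IsPolyFn2.comp2 {K : Type*} [Field K] {κ σ κ' σ' : Type*} {f : (κ → σ → K) → K}
    (hf : IsPolyFn2 f) {φ : (κ' → σ' → K) → κ → σ → K} (hφ : ∀ i s, IsPolyFn2 (fun x => φ x i s)) :
    IsPolyFn2 (fun x => f (φ x)) :=
  IsPolyFn2.comp (φ := fun (z : κ' × σ' → K) => φ (fun i s => z (i, s))) hf (fun i s => hφ i s)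

lemma isPolyFn2_apply {K : Type*} [Field K] {κ σ : Type*} (i : κ) (s : σ) :
    IsPolyFn2 (fun x : κ → σ → K => x i s) := isPolyFn_apply (i, s)

lemma isPolyFn2_const {K : Type*} [Field K] {κ σ : Type*} (a : K) :
    IsPolyFn2 (fun _ : κ → σ → K => a) := isPolyFn_const a

lemma IsPolyFn2.update {K : Type*} [Field K] {κ σ : Type*} [DecidableEq κ] {f : (κ → σ → K) → K}
    (hf : IsPolyFn2 f) (x : κ → σ → K) (i : κ) :
    IsPolyFn (fun s : σ → K => f (Function.update x i s)) := by
  refine hf.comp fun j t => ?_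
  by_cases h : j = i
  · subst h
    simpa using isPolyFn_apply t
  · simpa [h] using isPolyFn_const _

lemma irr_pi {K : Type*} [Field K] {κ σ : Type*} [Finite κ] {X : κ → Set (σ → K)}
    (hX : ∀ i, Irr (X i)) {f g : (κ → σ → K) → K} (hf : IsPolyFn2 f) (hg : IsPolyFn2 g)
    (hf0 : ∃ x : κ → σ → K, (∀ i, x i ∈ X i) ∧ f x ≠ 0)
    (hg0 : ∃ x : κ → σ → K, (∀ i, x i ∈ X i) ∧ g x ≠ 0) :
    ∃ x : κ → σ → K, (∀ i, x i ∈ X i) ∧ f x ≠ 0 ∧ g x ≠ 0 := by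
  classical
  cases nonempty_fintype κ
  have key : ∀ J : Finset κ, ∃ x y : κ → σ → K, (∀ i, x i ∈ X i) ∧ (∀ i, y i ∈ X i) ∧
      (∀ i ∈ J, x i = y i) ∧ f x ≠ 0 ∧ g y ≠ 0 := by
    intro J
    induction J using Finset.induction_on with
    | empty =>
      obtain ⟨x, hx, hx'⟩ := hf0
      obtain ⟨y, hy, hy'⟩ := hg0
      exact ⟨x, y, hx, hy, by simp, hx', hy'⟩
    | insert i J hi ih =>
      obtain ⟨x, y, hx, hy, hxy, hfx, hgy⟩ := ih
      obtain ⟨s, hs, h1, h2⟩ := (hX i).2 _ _ (hf.update x i) (hg.update y i)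
        ⟨x i, hx i, by simpa using hfx⟩ ⟨y i, hy i, by simpa using hgy⟩
      refine ⟨Function.update x i s, Function.update y i s, ?_, ?_, ?_, h1, h2⟩
      · intro j
        by_cases h : j = i
        · subst h; simpa using hs
        · simpa [h] using hx j
      · intro j
        by_cases h : j = i
        · subst h; simpa using hs
        · simpa [h] using hy j
      · intro j hj
        by_cases h : j = i
        · subst h; simp
        · simpa [h] using hxy j (Finset.mem_of_mem_insert_of_ne hj h)
  obtain ⟨x, y, hx, hy, hxy, h1, h2⟩ := key Finset.univ
  have : x = y := funext fun i => hxy i (Finset.mem_univ i)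
  subst this
  exact ⟨x, hx, h1, h2⟩

lemma Irr.prod {K : Type*} [Field K] {σ α : Type*} {X : Set (σ → K)} (hX : Irr X)
    (t : Finset α) (f : α → (σ → K) → K) (hf : ∀ a, IsPolyFn (f a))
    (h : ∀ a, ∃ x ∈ X, f a x ≠ 0) : ∃ x ∈ X, ∀ a ∈ t, f a x ≠ 0 := by
  classical
  induction t using Finset.induction_on with
  | empty =>
    obtain ⟨x, hx⟩ := hX.1
    exact ⟨x, hx, by simp⟩
  | insert a t ha ih =>
    obtain ⟨x, hx, hxt⟩ := ih
    obtain ⟨y, hy, h1, h2⟩ := hX.2 _ _ (hf a) (IsPolyFn.prod t hf) (h a)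
      ⟨x, hx, Finset.prod_ne_zero_iff.2 hxt⟩
    refine ⟨y, hy, fun b hb => ?_⟩
    rcases Finset.mem_insert.1 hb with rfl | hb
    · exact h1
    · exact Finset.prod_ne_zero_iff.1 h2 b hb

lemma chev {K : Type*} [Field K] [IsAlgClosed K] {σ τ : Type*} [Finite σ] [Finite τ]
    {X : Set (σ → K)} (hX : Irr X) (F : Set (MvPolynomial (σ ⊕ τ) K))
    (G : MvPolynomial (σ ⊕ τ) K)
    (hd : ∀ p : MvPolynomial σ K, (∃ x ∈ X, MvPolynomial.eval x p ≠ 0) →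
      ∃ x ∈ X, MvPolynomial.eval x p ≠ 0 ∧ ∃ z : τ → K,
        (∀ f ∈ F, MvPolynomial.eval (Sum.elim x z) f = 0) ∧
          MvPolynomial.eval (Sum.elim x z) G ≠ 0) :
    ∃ q : MvPolynomial σ K, (∃ x ∈ X, MvPolynomial.eval x q ≠ 0) ∧
      ∀ x ∈ X, MvPolynomial.eval x q ≠ 0 → ∃ z : τ → K,
        (∀ f ∈ F, MvPolynomial.eval (Sum.elim x z) f = 0) ∧
          MvPolynomial.eval (Sum.elim x z) G ≠ 0 := by
  classical
  let φ : MvPolynomial σ K →+* MvPolynomial (σ ⊕ τ) K := (MvPolynomial.rename Sum.inl).toRingHom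
  have hφ : φ.FinitePresentation := by
    refine RingHom.FinitePresentation.of_finiteType.1 ?_
    refine RingHom.FiniteType.of_comp_finiteType (f := MvPolynomial.C) ?_
    have : φ.comp MvPolynomial.C = algebraMap K (MvPolynomial (σ ⊕ τ) K) := by
      ext x; simp [φ, MvPolynomial.algebraMap_eq]
    rw [this]
    exact RingHom.finiteType_algebraMap.2 inferInstance
  let s : Set (PrimeSpectrum (MvPolynomial (σ ⊕ τ) K)) :=
    PrimeSpectrum.zeroLocus F \ PrimeSpectrum.zeroLocus {G}
  have hs : Topology.IsConstructible s := by
    obtain ⟨t, ht⟩ := (isNoetherianRing_iff_ideal_fg _).1 inferInstance (Ideal.span F)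
    have h1 : PrimeSpectrum.zeroLocus F = PrimeSpectrum.zeroLocus (t : Set (MvPolynomial (σ ⊕ τ) K)) := by
      rw [← PrimeSpectrum.zeroLocus_span F, ← ht, PrimeSpectrum.zeroLocus_span]
    refine .sdiff ?_ ?_
    · rw [h1, ← Topology.isConstructible_compl]
      exact (PrimeSpectrum.isRetrocompact_zeroLocus_compl t.finite_toSet).isConstructible
        (PrimeSpectrum.isClosed_zeroLocus _).isOpen_compl
    · rw [← Topology.isConstructible_compl]
      exact (PrimeSpectrum.isRetrocompact_zeroLocus_compl (Set.finite_singleton _)).isConstructible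
        (PrimeSpectrum.isClosed_zeroLocus _).isOpen_compl
  obtain ⟨D, hD⟩ := PrimeSpectrum.exists_constructibleSetData_iff.2
    (PrimeSpectrum.isConstructible_comap_image hφ hs)
  let pt : (σ → K) → PrimeSpectrum (MvPolynomial σ K) := MvPolynomial.pointToPoint (k := K)
  have mempt : ∀ x p, p ∈ (pt x).asIdeal ↔ MvPolynomial.eval x p = 0 := by
    intro x p
    simp only [pt, MvPolynomial.pointToPoint]
    rw [MvPolynomial.mem_vanishingIdeal_singleton_iff, MvPolynomial.aeval_eq_eval]
  have himg : ∀ x, pt x ∈ PrimeSpectrum.comap φ '' s ↔ ∃ z : τ → K,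
        (∀ f ∈ F, MvPolynomial.eval (Sum.elim x z) f = 0) ∧
          MvPolynomial.eval (Sum.elim x z) G ≠ 0 := by
    intro x
    constructor
    · rintro ⟨P, ⟨hPF, hPG⟩, hPx⟩
      have hPp := P.2
      have hP := MvPolynomial.IsPrime.vanishingIdeal_zeroLocus (K := K) P.asIdeal
      have hG : G ∉ P.asIdeal := by simpa using hPG
      rw [← hP, MvPolynomial.mem_vanishingIdeal_iff] at hG
      push Not at hG
      obtain ⟨y, hy, hGy⟩ := hG
      have hyx : y = Sum.elim x (fun t => y (Sum.inr t)) := by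
        funext a
        rcases a with a | a
        · have : (MvPolynomial.X a - MvPolynomial.C (x a)) ∈ (pt x).asIdeal := by
            rw [mempt]; simp
          rw [← hPx, PrimeSpectrum.comap_asIdeal, Ideal.mem_comap] at this
          have := hy _ this
          simp only [φ] at this
          simp [sub_eq_zero] at this
          simpa using this
        · rfl
      rw [MvPolynomial.aeval_eq_eval] at hGy
      refine ⟨fun t => y (Sum.inr t), ?_, ?_⟩
      · intro f hf
        rw [← hyx]
        have := hy f (hPF hf)
        rwa [MvPolynomial.aeval_eq_eval] at this
      · rw [← hyx]; exact hGy
    · rintro ⟨z, hz, hGz⟩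
      refine ⟨MvPolynomial.pointToPoint (k := K) (Sum.elim x z), ⟨?_, ?_⟩, ?_⟩
      · intro f hf
        have := hz f hf
        simp only [MvPolynomial.pointToPoint, SetLike.mem_coe]
        rw [MvPolynomial.mem_vanishingIdeal_singleton_iff, MvPolynomial.aeval_eq_eval]
        exact this
      · intro h
        have : G ∈ MvPolynomial.vanishingIdeal K {Sum.elim x z} := by
          simpa [MvPolynomial.pointToPoint] using h
        rw [MvPolynomial.mem_vanishingIdeal_singleton_iff, MvPolynomial.aeval_eq_eval] at this
        exact hGz this
      · ext p
        rw [mempt, PrimeSpectrum.comap_asIdeal, Ideal.mem_comap]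
        simp only [MvPolynomial.pointToPoint]
        rw [MvPolynomial.mem_vanishingIdeal_singleton_iff, MvPolynomial.aeval_eq_eval]
        simp [φ, MvPolynomial.eval_rename]
  have hmem : ∀ x, pt x ∈ PrimeSpectrum.comap φ '' s ↔ ∃ d ∈ D,
      (∀ i, MvPolynomial.eval x (d.g i) = 0) ∧ MvPolynomial.eval x d.f ≠ 0 := by
    intro x
    rw [← hD]
    simp [PrimeSpectrum.ConstructibleSetData.toSet, PrimeSpectrum.BasicConstructibleSetData.toSet,
      PrimeSpectrum.mem_zeroLocus, Set.range_subset_iff, mempt]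
    exact exists_congr fun d => by tauto
  by_cases hcase : ∃ d ∈ D, (∀ i, ∀ x ∈ X, MvPolynomial.eval x (d.g i) = 0) ∧
      ∃ x ∈ X, MvPolynomial.eval x d.f ≠ 0
  · obtain ⟨d, hdD, hdg, hdf⟩ := hcase
    refine ⟨d.f, hdf, fun x hx hxf => ?_⟩
    rw [← himg, hmem]
    exact ⟨d, hdD, fun i => hdg i x hx, hxf⟩
  · exfalso
    push Not at hcase
    have : ∀ d : PrimeSpectrum.BasicConstructibleSetData (MvPolynomial σ K),
        ∃ p : MvPolynomial σ K, (∃ x ∈ X, MvPolynomial.eval x p ≠ 0) ∧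
          (d ∈ D → ∀ x ∈ X, MvPolynomial.eval x p ≠ 0 →
            (∀ i, MvPolynomial.eval x (d.g i) = 0) → MvPolynomial.eval x d.f = 0) := by
      intro d
      by_cases h : ∀ i, ∀ x ∈ X, MvPolynomial.eval x (d.g i) = 0
      · obtain ⟨x, hx⟩ := hX.1
        exact ⟨1, ⟨x, hx, by simp⟩, fun hdD x hx _ _ => hcase d hdD h x hx⟩
      · push Not at h
        obtain ⟨i, x, hx, hxi⟩ := h
        exact ⟨d.g i, ⟨x, hx, hxi⟩, fun _ y _ hy h' => absurd (h' i) hy⟩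
    choose p hp1 hp2 using this
    obtain ⟨x, hx, hxp⟩ := hX.prod D (fun d x => MvPolynomial.eval x (p d))
      (fun d => isPolyFn_eval _) hp1
    obtain ⟨y, hy, hyp, hyz⟩ := hd (∏ d ∈ D, p d) ⟨x, hx, by
      rw [map_prod]; exact Finset.prod_ne_zero_iff.2 hxp⟩
    rw [← himg, hmem] at hyz
    obtain ⟨d, hdD, hg, hf⟩ := hyz
    rw [map_prod] at hyp
    exact hf (hp2 d hdD y hy (Finset.prod_ne_zero_iff.1 hyp d hdD) hg)

/-- ideal of polynomials vanishing on a set -/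
def vI {K : Type*} [Field K] {σ : Type*} (E : Set (σ → K)) : Ideal (MvPolynomial σ K) where
  carrier := {p | ∀ x ∈ E, MvPolynomial.eval x p = 0}
  add_mem' := by
    intro p q hp hq x hx
    simp [hp x hx, hq x hx]
  zero_mem' := by
    intro x hx
    simp
  smul_mem' := by
    intro c p hp x hx
    simp [hp x hx]

lemma mem_vI {K : Type*} [Field K] {σ : Type*} {E : Set (σ → K)} {p : MvPolynomial σ K} :
    p ∈ vI E ↔ ∀ x ∈ E, MvPolynomial.eval x p = 0 := Iff.rfl

lemma Irr.isPrime {K : Type*} [Field K] {σ : Type*} {E : Set (σ → K)} (hE : Irr E) :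
    (vI E).IsPrime := by
  refine ⟨?_, ?_⟩
  · intro h
    obtain ⟨x, hx⟩ := hE.1
    have : (1 : MvPolynomial σ K) ∈ vI E := by rw [h]; trivial
    simpa using this x hx
  · intro p q hpq
    by_contra hcon
    push Not at hcon
    obtain ⟨h1, h2⟩ := hcon
    rw [mem_vI] at h1 h2
    push Not at h1 h2
    obtain ⟨x, hx, h3, h4⟩ := hE.2 _ _ (isPolyFn_eval p) (isPolyFn_eval q) h1 h2
    have := hpq x hx
    rw [map_mul] at this
    exact (mul_ne_zero h3 h4) this

/-- there is a chain of primes of length `k` above the ideal of `E` -/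
def HasChain {K : Type*} [Field K] {σ : Type*} (E : Set (σ → K)) (k : ℕ) : Prop :=
  ∃ s : LTSeries (PrimeSpectrum (MvPolynomial σ K)), s.head.asIdeal = vI E ∧ s.length = k

lemma HasChain.step {K : Type*} [Field K] {σ : Type*} {E E' : Set (σ → K)} {k : ℕ}
    (h : HasChain E k) (hE' : Irr E') (hlt : vI E' < vI E) : HasChain E' (k + 1) := by
  obtain ⟨s, hs, rfl⟩ := h
  refine ⟨s.cons ⟨vI E', hE'.isPrime⟩ ?_, ?_, ?_⟩
  · show (_ : PrimeSpectrum (MvPolynomial σ K)) < _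
    rw [← PrimeSpectrum.asIdeal_lt_asIdeal, hs]
    exact hlt
  · simp
  · simp

lemma HasChain.bound {K : Type*} [Field K] {σ : Type*} [Fintype σ] {E : Set (σ → K)} {k : ℕ}
    (h : HasChain E k) (hE : vI E ≠ ⊥) : k + 1 ≤ Fintype.card σ := by
  obtain ⟨s, hs, rfl⟩ := h
  let t : LTSeries (PrimeSpectrum (MvPolynomial σ K)) :=
    s.cons ⟨⊥, Ideal.isPrime_bot⟩ (by
      show (_ : PrimeSpectrum (MvPolynomial σ K)) < _
      rw [← PrimeSpectrum.asIdeal_lt_asIdeal, hs]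
      exact bot_lt_iff_ne_bot.2 hE)
  have h1 := Order.LTSeries.length_le_krullDim t
  have h2 : ringKrullDim (MvPolynomial σ K) = Fintype.card σ := by
    rw [MvPolynomial.ringKrullDim_of_isNoetherianRing]
    simp
  have h3 : ((t.length : ℕ) : WithBot ℕ∞) ≤ ((Fintype.card σ : ℕ) : WithBot ℕ∞) := by
    rw [← h2]; exact h1
  have h4 : t.length ≤ Fintype.card σ := by exact_mod_cast h3
  simpa [t] using h4

lemma exists_move {K : Type*} [Field K] [Infinite K] {σ : Type*} {C E : Set (σ → K)}
    (hC : Submodule.span K C = ⊤) (hE0 : E.Nonempty)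
    (hEs : ∀ t : K, t ≠ 0 → ∀ e ∈ E, t • e ∈ E) (hE : vI E ≠ ⊥) :
    ∃ s ∈ C, ∃ f ∈ vI E, ∃ e ∈ E, MvPolynomial.eval (e + s) f ≠ 0 := by
  by_contra hcon
  push Not at hcon
  have key : ∀ s : σ → K, ∀ f ∈ vI E, ∀ e ∈ E, MvPolynomial.eval (e + s) f = 0 := by
    intro s
    have hs : s ∈ Submodule.span K C := by rw [hC]; trivial
    induction hs using Submodule.span_induction with
    | mem x hx => exact fun f hf e he => hcon x hx f hf e he
    | zero => exact fun f hf e he => by simpa using hf e he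
    | add s1 s2 _ _ h1 h2 =>
      intro f hf e he
      obtain ⟨g, hg⟩ : IsPolyFn (fun x : σ → K => MvPolynomial.eval (x + s2) f) :=
        (isPolyFn_eval f).comp (φ := fun i x => x i + s2 i)
          (fun i => (isPolyFn_apply i).add (isPolyFn_const _))
      have hgE : g ∈ vI E := fun x hx => by rw [hg]; exact h2 f hf x hx
      have := h1 g hgE e he
      rw [hg] at this
      rw [← add_assoc]; exact this
    | smul t s _ h =>
      intro f hf e he
      by_cases ht : t = 0
      · simpa [ht] using hf e he
      obtain ⟨g, hg⟩ : IsPolyFn (fun x : σ → K => MvPolynomial.eval (t • x) f) :=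
        (isPolyFn_eval f).comp (φ := fun i x => t * x i)
          (fun i => (isPolyFn_const _).mul (isPolyFn_apply i))
      have hgE : g ∈ vI E := fun x hx => by rw [hg]; exact hf _ (hEs t ht x hx)
      have := h g hgE (t⁻¹ • e) (hEs _ (inv_ne_zero ht) e he)
      rw [hg] at this
      simpa [smul_add, smul_smul, ht] using this
  apply hE
  rw [eq_bot_iff]
  intro f hf
  obtain ⟨e, he⟩ := hE0
  refine (Ideal.mem_bot).2 (MvPolynomial.funext fun z => ?_)
  simpa using key (z - e) f hf e he

lemma irr_addline {K : Type*} [Field K] [Infinite K] {σ : Type*} {E : Set (σ → K)} (hE : Irr E)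
    (s : σ → K) : Irr {v | ∃ e ∈ E, ∃ t : K, v = e + t • s} := by
  refine ⟨?_, ?_⟩
  · obtain ⟨e, he⟩ := hE.1
    exact ⟨e, e, he, 0, by simp⟩
  · rintro f g hf hg ⟨_, ⟨e1, he1, t1, rfl⟩, h1⟩ ⟨_, ⟨e2, he2, t2, rfl⟩, h2⟩
    have aux : ∀ {f : (σ → K) → K}, IsPolyFn f → ∀ t : K, IsPolyFn (fun x => f (x + t • s)) :=
      fun hf t => hf.comp (φ := fun i x => x i + t * s i)
          (fun i => (isPolyFn_apply i).add (isPolyFn_const _))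
    have aux2 : ∀ {f : (σ → K) → K}, IsPolyFn f → ∀ e : σ → K,
        IsPolyFn (fun x : Unit → K => f (e + x () • s)) :=
      fun hf e => hf.comp (φ := fun i x => e i + x () * s i)
          (fun i => (isPolyFn_const _).add ((isPolyFn_apply ()).mul (isPolyFn_const _)))
    obtain ⟨e, he, h3, h4⟩ := hE.2 _ _ (aux hf t1) (aux hg t2) ⟨e1, he1, h1⟩ ⟨e2, he2, h2⟩
    obtain ⟨t, -, h5, h6⟩ := irr_univ.2 _ _ (aux2 hf e) (aux2 hg e)
      ⟨fun _ => t1, trivial, h3⟩ ⟨fun _ => t2, trivial, h4⟩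
    exact ⟨_, ⟨e, he, t (), rfl⟩, h5, h6⟩

/-- the cone over the join of `C` with some of the points `x i` -/
def jn {K : Type*} [Field K] {κ σ : Type*} (C : Set (σ → K)) (x : κ → σ → K) (J : Finset κ) :
    Set (σ → K) :=
  {v | ∃ w ∈ C, ∃ a : κ → K, v = w + ∑ i ∈ J, a i • x i}

lemma jn_insert {K : Type*} [Field K] {κ σ : Type*} [DecidableEq κ] (C : Set (σ → K))
    (x : κ → σ → K) (J : Finset κ) (i : κ) (hi : i ∉ J) (s : σ → K) :
    jn C (Function.update x i s) (insert i J) = {v | ∃ e ∈ jn C x J, ∃ t : K, v = e + t • s} := by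
  have h0 : ∀ a : κ → K, ∑ j ∈ J, a j • Function.update x i s j = ∑ j ∈ J, a j • x j := by
    intro a
    refine Finset.sum_congr rfl fun j hj => ?_
    rw [Function.update_of_ne]
    rintro rfl
    exact hi hj
  ext v
  constructor
  · rintro ⟨w, hw, a, rfl⟩
    refine ⟨w + ∑ j ∈ J, a j • x j, ⟨w, hw, a, rfl⟩, a i, ?_⟩
    rw [Finset.sum_insert hi, h0]
    simp only [Function.update_self]
    abel
  · rintro ⟨_, ⟨w, hw, a, rfl⟩, t, rfl⟩
    refine ⟨w, hw, Function.update a i t, ?_⟩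
    rw [Finset.sum_insert hi, h0]
    have : ∑ j ∈ J, Function.update a i t j • x j = ∑ j ∈ J, a j • x j := by
      refine Finset.sum_congr rfl fun j hj => ?_
      rw [Function.update_of_ne]
      rintro rfl
      exact hi hj
    rw [this]
    simp only [Function.update_self]
    abel

lemma core {K : Type*} [Field K] [Infinite K] {κ σ : Type*} [DecidableEq κ] {C : Set (σ → K)}
    (hC : Irr C) (hCs : ∀ t : K, ∀ e ∈ C, t • e ∈ C) (hCt : Submodule.span K C = ⊤) {k : ℕ}
    (hk : HasChain C k) {Z : κ → Set (σ → K)} (hZ : ∀ i, Irr (Z i)) (hCZ : ∀ i, C ⊆ Z i)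
    {P : (κ → σ → K) → K} (hP : IsPolyFn2 P) (x : κ → σ → K) (hx : ∀ i, x i ∈ Z i)
    (hPx : P x ≠ 0) (J : Finset κ) :
    ∃ x' : κ → σ → K, (∀ i, x' i ∈ Z i) ∧ P x' ≠ 0 ∧ Irr (jn C x' J) ∧
      (vI (jn C x' J) = ⊥ ∨ HasChain (jn C x' J) (k + J.card)) := by
  induction J using Finset.induction_on with
  | empty =>
    have : jn C x (∅ : Finset κ) = C := by
      ext v; simp [jn]
    exact ⟨x, hx, hPx, by rw [this]; exact hC, Or.inr (by rw [this]; exact hk)⟩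
  | insert i J hi ih =>
    obtain ⟨x, hx, hPx, hirr, hor⟩ := ih
    have hscale : ∀ t : K, t ≠ 0 → ∀ e ∈ jn C x J, t • e ∈ jn C x J := by
      rintro t - _ ⟨w, hw, a, rfl⟩
      refine ⟨t • w, hCs t w hw, t • a, ?_⟩
      simp [smul_add, Finset.smul_sum, smul_smul]
    have hsub : ∀ s, vI (jn C (Function.update x i s) (insert i J)) ≤ vI (jn C x J) := by
      intro s f hf e he
      refine hf e ?_
      rw [jn_insert _ _ _ _ hi]
      exact ⟨e, he, 0, by simp⟩
    by_cases hb : vI (jn C x J) = ⊥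
    · refine ⟨Function.update x i (x i), ?_, ?_, ?_, Or.inl ?_⟩
      · simpa using hx
      · simpa using hPx
      · rw [jn_insert _ _ _ _ hi]; exact irr_addline hirr _
      · exact eq_bot_iff.2 ((hsub _).trans hb.le)
    · obtain ⟨s0, hs0, f, hf, e, he, hne⟩ := exists_move hCt hirr.1 hscale hb
      obtain ⟨s, hs, h1, h2⟩ := (hZ i).2 _ _ (hP.update x i)
        ((isPolyFn_eval f).comp (φ := fun i x => e i + x i)
          (fun i => (isPolyFn_const _).add (isPolyFn_apply i)))
        ⟨x i, hx i, by simpa using hPx⟩ ⟨s0, hCZ i hs0, hne⟩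
      have hirr' : Irr (jn C (Function.update x i s) (insert i J)) := by
        rw [jn_insert _ _ _ _ hi]; exact irr_addline hirr _
      refine ⟨Function.update x i s, ?_, h1, hirr', Or.inr ?_⟩
      · intro j
        by_cases h : j = i
        · subst h; simpa using hs
        · simpa [h] using hx j
      · rw [Finset.card_insert_of_notMem hi, ← add_assoc]
        refine (hor.resolve_left hb).step hirr' (lt_of_le_of_ne (hsub s) ?_)
        intro heq
        have : f ∈ vI (jn C (Function.update x i s) (insert i J)) := heq ▸ hf
        refine h2 (this _ ?_)
        rw [jn_insert _ _ _ _ hi]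
        exact ⟨e, he, 1, by simp; rfl⟩

lemma dom1 {K : Type*} [Field K] [Infinite K] {σ : Type*} [Fintype σ] [DecidableEq σ]
    {C : Set (σ → K)}
    (hC : Irr C) (hCs : ∀ t : K, ∀ e ∈ C, t • e ∈ C) (hCt : Submodule.span K C = ⊤) {k : ℕ}
    (hk : HasChain C k) (J0 : Finset σ) (hJ0 : Fintype.card σ + 1 ≤ k + J0.card)
    {G : (σ → σ → K) → K} (hG : IsPolyFn2 G) (hG0 : ∃ w : σ → σ → K, (∀ i, w i ∈ C) ∧ G w ≠ 0)
    (D : Finset σ) (hD : D ⊆ J0) : ∀ (P : (σ → σ → K) → K) (_hP : IsPolyFn2 P)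
    (_hPQ : ∀ X : σ → σ → K, (∃ w : σ → σ → K, (∀ i, w i ∈ C) ∧ G w ≠ 0 ∧
      ∀ i ∈ J0, w i ∈ Submodule.span K (X '' J0)) → P X = 0)
    (x : σ → σ → K) (_hx : ∀ i ∈ J0, i ∉ D → x i ∈ C), P x = 0 := by
  induction D using Finset.induction_on with
  | empty =>
    intro P hP hPQ x hx
    by_contra hne
    obtain ⟨c0, hc0⟩ := hC.1
    have hpoly : IsPolyFn2 (fun w : σ → σ → K => P (fun i => if i ∈ J0 then w i else x i)) := by
      refine hP.comp2 fun i s => ?_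
      by_cases h : i ∈ J0
      · simpa [h] using isPolyFn2_apply i s
      · simpa [h] using isPolyFn2_const _
    obtain ⟨w, hw, h1, h2⟩ := irr_pi (X := fun _ : σ => C) (fun _ => hC) hpoly hG
      ⟨fun i => if i ∈ J0 then x i else c0, by
        intro i
        by_cases h : i ∈ J0
        · simpa [h] using hx i h (by simp)
        · simpa [h] using hc0, by
        convert hne using 2
        funext i
        by_cases h : i ∈ J0 <;> simp [h]⟩ hG0
    refine h1 (hPQ _ ⟨w, hw, h2, fun i hi => Submodule.subset_span ⟨i, hi, ?_⟩⟩)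
    simp [hi]
  | insert k D hkD ih =>
    intro P hP hPQ x hx
    by_contra hne
    have hkJ : k ∈ J0 := hD (Finset.mem_insert_self _ _)
    have ih := ih fun i hi => hD (Finset.mem_insert_of_mem hi)
    obtain ⟨x', hx', hPx', -, hor⟩ := core hC hCs hCt hk
      (Z := fun i => if i ∈ J0 ∧ i ∉ insert k D then C else Set.univ)
      (by
        intro i
        show Irr (if _ then _ else _)
        split_ifs
        · exact hC
        · exact irr_univ)
      (by
        intro i
        show C ⊆ (if _ then _ else _)
        split_ifs
        · exact subset_rfl
        · exact Set.subset_univ _)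
      hP x (by
        intro i
        by_cases h : i ∈ J0 ∧ i ∉ insert k D
        · simpa only [if_pos h] using hx i h.1 h.2
        · simp only [if_neg h]; trivial) hne (J0.erase k)
    have hbot : vI (jn C x' (J0.erase k)) = ⊥ := by
      rcases hor with h | h
      · exact h
      · by_contra hb
        have := h.bound hb
        rw [Finset.card_erase_of_mem hkJ] at this
        have := Finset.card_pos.2 ⟨k, hkJ⟩
        omega
    obtain ⟨q, hq⟩ := hP.update x' k
    have hqn : q ∉ vI (jn C x' (J0.erase k)) := by
      rw [hbot, Ideal.mem_bot]
      rintro rfl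
      have := hq (x' k)
      simp at this
      exact hPx' this.symm
    rw [mem_vI] at hqn
    push Not at hqn
    obtain ⟨e, ⟨w, hw, a, rfl⟩, hqe⟩ := hqn
    rw [hq] at hqe
    let A : (σ → σ → K) → (σ → σ → K) := fun X =>
      Function.update X k (X k + ∑ i ∈ J0.erase k, a i • X i)
    have hAne : ∀ X i, i ≠ k → A X i = X i := fun X i h => by simp [A, h]
    have hAk : ∀ X, A X k = X k + ∑ i ∈ J0.erase k, a i • X i := fun X => by simp [A]
    have hPA : IsPolyFn2 (fun X => P (A X)) := by
      refine hP.comp2 fun i s => ?_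
      by_cases h : i = k
      · subst h
        simp only [hAk, Pi.add_apply, Finset.sum_apply, Pi.smul_apply, smul_eq_mul]
        exact IsPolyFn.add (isPolyFn2_apply _ _) (IsPolyFn.sum _ fun j =>
          (isPolyFn_const _).mul (isPolyFn2_apply _ _))
      · simp only [hAne _ i h]
        exact isPolyFn2_apply _ _
    have hPAQ : ∀ X : σ → σ → K, (∃ w : σ → σ → K, (∀ i, w i ∈ C) ∧ G w ≠ 0 ∧
        ∀ i ∈ J0, w i ∈ Submodule.span K (X '' J0)) → P (A X) = 0 := by
      rintro X ⟨w, hw, hGw, hs⟩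
      refine hPQ _ ⟨w, hw, hGw, fun i hi => ?_⟩
      have hle : Submodule.span K (X '' J0) ≤ Submodule.span K (A X '' J0) := by
        rw [Submodule.span_le]
        have h1 : ∀ l ∈ J0, l ≠ k → X l ∈ Submodule.span K (A X '' J0) := fun l hl hlk =>
          Submodule.subset_span ⟨l, hl, hAne X l hlk⟩
        rintro _ ⟨l, hl, rfl⟩
        by_cases hlk : l = k
        · subst hlk
          have : X l = A X l - ∑ i ∈ J0.erase l, a i • X i := by rw [hAk]; abel
          rw [SetLike.mem_coe, this]
          refine Submodule.sub_mem _ (Submodule.subset_span ⟨l, hl, rfl⟩)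
            (Submodule.sum_mem _ fun j hj => Submodule.smul_mem _ _ (h1 j ?_ ?_))
          · exact Finset.mem_of_mem_erase hj
          · exact Finset.ne_of_mem_erase hj
        · exact h1 l hl hlk
      exact hle (hs i hi)
    refine hqe ?_
    have := ih _ hPA hPAQ (Function.update x' k w) ?_
    · convert this using 2
      funext i
      by_cases h : i = k
      · subst h
        rw [hAk]
        simp only [Function.update_self]
        congr 1
        refine Finset.sum_congr rfl fun j hj => ?_
        rw [Function.update_of_ne (Finset.ne_of_mem_erase hj)]
      · rw [hAne _ _ h, Function.update_of_ne h, Function.update_of_ne h]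
    · intro i hi hiD
      by_cases h : i = k
      · subst h; simpa using hw
      · have h3 := hx' i
        have h4 : i ∈ J0 ∧ i ∉ insert k D := ⟨hi, by simp [h, hiD]⟩
        simp only [if_pos h4] at h3
        rwa [Function.update_of_ne h]

lemma dom {K : Type*} [Field K] [Infinite K] {σ : Type*} [Fintype σ] [DecidableEq σ]
    {C : Set (σ → K)}
    (hC : Irr C) (hCs : ∀ t : K, ∀ e ∈ C, t • e ∈ C) (hCt : Submodule.span K C = ⊤) {k : ℕ}
    (hk : HasChain C k) (J0 : Finset σ) (hJ0 : Fintype.card σ + 1 ≤ k + J0.card)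
    {n : ℕ} (eN : Fin n → σ) (hinj : Function.Injective eN) (heN : ∀ j, eN j ∉ J0)
    {G : (σ → σ → K) → K} (hG : IsPolyFn2 G) (hG0 : ∃ w : σ → σ → K, (∀ i, w i ∈ C) ∧ G w ≠ 0)
    {p : (Fin n → σ → K) → K} (hp : IsPolyFn2 p) (hp0 : ∃ h, p h ≠ 0) :
    ∃ h, p h ≠ 0 ∧ ∃ w : σ → σ → K, (∀ i, w i ∈ C) ∧ G w ≠ 0 ∧
      ∀ j, ∀ i ∈ J0, ∑ l, h j l * w i l = 0 := by
  obtain ⟨h0, hh0⟩ := hp0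
  have hp1 : IsPolyFn2 (fun M : σ → σ → K => p (fun j l => M l (eN j))) :=
    hp.comp2 fun j l => isPolyFn2_apply _ _
  have hp2 : IsPolyFn2 (fun M : σ → σ → K => (Matrix.of M).det) :=
    IsPolyFn.det fun i j => isPolyFn_apply (i, j)
  obtain ⟨H, -, hH1, hH2⟩ := irr_pi (X := fun _ : σ => Set.univ) (fun _ => irr_univ) hp1 hp2
    ⟨fun l i => Function.extend eN (fun j => h0 j l) 0 i, fun _ => trivial, by
      simpa [hinj.extend_apply] using hh0⟩
    ⟨(1 : Matrix σ σ K), fun _ => trivial, by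
      show (1 : Matrix σ σ K).det ≠ 0
      simp⟩
  let Hm : Matrix σ σ K := Matrix.of H
  by_contra hcon
  push Not at hcon
  let hh : (σ → σ → K) → Fin n → σ → K := fun X j l =>
    (Hm * (Matrix.of X * Hm).adjugate) l (eN j)
  have hhp : IsPolyFn2 (fun X => p (hh X)) := by
    refine hp.comp2 fun j l => ?_
    simp only [hh, Matrix.mul_apply (M := Hm)]
    refine IsPolyFn.sum _ fun i => (isPolyFn_const _).mul (IsPolyFn.adjugate (fun a b => ?_) _ _)
    simp only [Matrix.mul_apply, Matrix.of_apply]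
    exact IsPolyFn.sum _ fun i => (isPolyFn_apply (a, i)).mul (isPolyFn_const _)
  have hz := dom1 hC hCs hCt hk J0 hJ0 hG hG0 J0 subset_rfl _ hhp ?_ (Hm⁻¹ : Matrix σ σ K) ?_
  · apply hH1
    convert hz using 2
    funext j l
    have : (Matrix.of (Hm⁻¹ : Matrix σ σ K) * Hm) = 1 :=
      Matrix.nonsing_inv_mul Hm (isUnit_iff_ne_zero.2 hH2)
    simp only [hh, this, Matrix.adjugate_one, Matrix.mul_one]
    rfl
  · rintro X ⟨w, hw, hGw, hs⟩
    by_contra hne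
    obtain ⟨j, i, hi, hne'⟩ := hcon _ hne w hw hGw
    apply hne'
    have hb := hs i hi
    generalize w i = z at hb
    induction hb using Submodule.span_induction with
    | mem z hz =>
      obtain ⟨l, hl, rfl⟩ := hz
      have h1 : (Matrix.of X * (Hm * (Matrix.of X * Hm).adjugate)) l (eN j) = 0 := by
        rw [← Matrix.mul_assoc, Matrix.mul_adjugate, Matrix.smul_apply, Matrix.one_apply_ne]
        · simp
        · rintro rfl
          exact heN j hl
      rw [Matrix.mul_apply] at h1
      rw [← h1]
      refine Finset.sum_congr rfl fun a _ => ?_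
      simp only [hh, Matrix.of_apply]
      ring
    | zero => simp
    | add a b _ _ ha hb => simp [mul_add, Finset.sum_add_distrib, ha, hb]
    | smul t a _ ha =>
      have : ∑ l, hh X j l * (t • a) l = t * ∑ l, hh X j l * a l := by
        rw [Finset.mul_sum]
        exact Finset.sum_congr rfl fun l _ => by simp; ring
      rw [this, ha, mul_zero]
  · intro i hi hi'
    exact absurd hi hi'

lemma comps {K : Type*} [Field K] [Infinite K] {σ κ : Type*} (π : σ → κ)
    (P : MvPolynomial σ K) : ∃ comp : (κ →₀ ℕ) → MvPolynomial σ K,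
      (∀ d m, MvPolynomial.coeff m (comp d) ≠ 0 → Finsupp.mapDomain π m = d) ∧
      (∀ v, (∀ d, MvPolynomial.eval v (comp d) = 0) → MvPolynomial.eval v P = 0) ∧
      (∀ v, (∀ t : κ → K, MvPolynomial.eval (fun s => t (π s) * v s) P = 0) →
        ∀ d, MvPolynomial.eval v (comp d) = 0) := by
  classical
  refine ⟨fun d => ∑ m ∈ P.support with Finsupp.mapDomain π m = d,
    MvPolynomial.monomial m (MvPolynomial.coeff m P), ?_, ?_, ?_⟩
  · intro d m hm
    rw [MvPolynomial.coeff_sum] at hm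
    obtain ⟨m', hm', hne⟩ := Finset.exists_ne_zero_of_sum_ne_zero hm
    rw [MvPolynomial.coeff_monomial] at hne
    have : m' = m := by
      by_contra h
      simp [h] at hne
    subst this
    exact (Finset.mem_filter.1 hm').2
  · intro v hv
    have h1 : P = ∑ d ∈ P.support.image (Finsupp.mapDomain π),
        ∑ m ∈ P.support with Finsupp.mapDomain π m = d,
          MvPolynomial.monomial m (MvPolynomial.coeff m P) := by
      rw [Finset.sum_fiberwise_of_maps_to (fun m hm => Finset.mem_image_of_mem _ hm)]
      exact P.support_sum_monomial_coeff.symm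
    rw [h1, map_sum]
    exact Finset.sum_eq_zero fun d _ => hv d
  · intro v hv d
    let Q : MvPolynomial κ K := ∑ m ∈ P.support, MvPolynomial.monomial (Finsupp.mapDomain π m)
      (MvPolynomial.eval v (MvPolynomial.monomial m (MvPolynomial.coeff m P)))
    have hQ : Q = 0 := by
      refine MvPolynomial.funext fun t => ?_
      rw [map_zero, ← hv t]
      conv_rhs => rw [← P.support_sum_monomial_coeff]
      simp only [Q, map_sum]
      refine Finset.sum_congr rfl fun m _ => ?_
      simp only [MvPolynomial.eval_monomial]
      rw [Finsupp.prod_mapDomain_index (by simp) (by intros; rw [pow_add]), mul_assoc]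
      congr 1
      rw [mul_comm, ← Finsupp.prod_mul]
      refine Finsupp.prod_congr fun s _ => ?_
      rw [mul_pow]
    have h2 : MvPolynomial.coeff d Q = 0 := by rw [hQ]; simp
    rw [map_sum, ← h2]
    simp only [Q, MvPolynomial.coeff_sum, MvPolynomial.coeff_monomial]
    rw [Finset.sum_filter]

lemma weight_of_mapDomain {σ κ : Type*} [DecidableEq κ] (π : σ → κ) (m : σ →₀ ℕ) (i : κ) :
    Finsupp.weight (fun s => if π s = i then 1 else 0) m = Finsupp.mapDomain π m i := by
  rw [Finsupp.weight_apply, Finsupp.mapDomain, Finsupp.sum_apply]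
  refine Finsupp.sum_congr fun s _ => ?_
  by_cases h : π s = i <;> simp [h]

lemma mem_coneOf {K : Type*} [Field K] {ι : Type*} {Z : Set (PP K ι)} {v : ι → K} :
    v ∈ coneOf Z ↔ ∃ x ∈ Z, v ∈ x.submodule := by
  simp [coneOf]

lemma isZClosed_of_poly {K : Type*} [Field K] [Infinite K] {ι : Type*}
    (f : MvPolynomial ι K) :
    IsZClosed {x : PP K ι | ∀ v ∈ x.submodule, MvPolynomial.eval v f = 0} := by
  obtain ⟨comp, h1, h2, h3⟩ := comps (fun _ : ι => ()) f
  refine ⟨Set.range comp, ?_, ?_⟩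
  · rintro _ ⟨d, rfl⟩
    refine ⟨d (), ?_⟩
    intro m hm
    have := weight_of_mapDomain (fun _ : ι => ()) m ()
    rw [h1 d m hm] at this
    rw [← this]
    simp
    rfl
  · ext x
    constructor
    · rintro hx _ ⟨d, rfl⟩ v hv
      refine h3 v (fun t => ?_) d
      exact hx (t () • v) (Submodule.smul_mem _ _ hv)
    · intro hx v hv
      exact h2 v fun d => hx _ ⟨d, rfl⟩ v hv

lemma isMultiZClosed_of_poly {K : Type*} [Field K] [Infinite K] {ι : Type*} {m : ℕ}
    (f : MvPolynomial (Fin m × ι) K) :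
    IsMultiZClosed {u : Fin m → PP K ι | ∀ v : Fin m → ι → K, (∀ i, v i ∈ (u i).submodule) →
      MvPolynomial.eval (fun p => v p.1 p.2) f = 0} := by
  obtain ⟨comp, h1, h2, h3⟩ := comps (fun p : Fin m × ι => p.1) f
  refine ⟨Set.range comp, ?_, ?_⟩
  · rintro _ ⟨d, rfl⟩ i
    refine ⟨d i, ?_⟩
    intro m hm
    rw [weight_of_mapDomain (fun p : Fin _ × ι => p.1) m i, h1 d m hm]
  · ext x
    constructor
    · rintro hx _ ⟨d, rfl⟩ v hv
      refine h3 _ (fun t => ?_) d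
      exact hx (fun i => t i • v i) (fun i => Submodule.smul_mem _ _ (hv i))
    · intro hx v hv
      exact h2 _ fun d => hx _ ⟨d, rfl⟩ v hv

lemma cone_smul {K : Type*} [Field K] {ι : Type*} {Z : Set (PP K ι)} (t : K) (v : ι → K)
    (hv : v ∈ coneOf Z) : t • v ∈ coneOf Z := by
  rw [mem_coneOf] at hv ⊢
  obtain ⟨x, hx, hv⟩ := hv
  exact ⟨x, hx, Submodule.smul_mem _ _ hv⟩

lemma rep_mem {K : Type*} [Field K] {ι : Type*} (x : PP K ι) : x.rep ∈ x.submodule := by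
  rw [Projectivization.submodule_eq]
  exact Submodule.mem_span_singleton_self _

lemma mem_sub_iff {K : Type*} [Field K] {ι : Type*} (x : PP K ι) (v : ι → K) :
    v ∈ x.submodule ↔ ∃ t : K, t • x.rep = v := by
  rw [Projectivization.submodule_eq, Submodule.mem_span_singleton]

lemma mk_mem_of_cone {K : Type*} [Field K] {ι : Type*} {Z : Set (PP K ι)} {v : ι → K}
    (hv : v ∈ coneOf Z) (h0 : v ≠ 0) : Projectivization.mk K v h0 ∈ Z := by
  rw [mem_coneOf] at hv
  obtain ⟨x, hx, hv⟩ := hv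
  obtain ⟨t, ht⟩ := (mem_sub_iff x v).1 hv
  have : Projectivization.mk K v h0 = x := by
    conv_rhs => rw [← x.mk_rep]
    exact (Projectivization.mk_eq_mk_iff' K _ _ h0 x.rep_nonzero).2 ⟨t, ht⟩
  rw [this]; exact hx

lemma cone_irr {K : Type*} [Field K] [Infinite K] {ι : Type*} {Z : Set (PP K ι)}
    (hZ : IsZIrreducible Z) : Irr (coneOf Z) := by
  refine ⟨?_, ?_⟩
  · obtain ⟨x, hx⟩ := hZ.1
    exact ⟨x.rep, mem_coneOf.2 ⟨x, hx, rep_mem x⟩⟩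
  · rintro f g ⟨p, hp⟩ ⟨q, hq⟩ ⟨a, ha, hfa⟩ ⟨b, hb, hgb⟩
    by_contra hcon
    push Not at hcon
    rw [mem_coneOf] at ha hb
    obtain ⟨x, hx, ha⟩ := ha
    obtain ⟨y, hy, hb⟩ := hb
    have hor := hZ.2 _ _ (isZClosed_of_poly p) (isZClosed_of_poly q) ?_
    · rcases hor with h | h
      · exact hfa (by rw [← hp]; exact h hx a ha)
      · exact hgb (by rw [← hq]; exact h hy b hb)
    · intro z hz
      by_contra hzn
      simp only [Set.mem_union, Set.mem_ofPred_eq, not_or] at hzn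
      push Not at hzn
      obtain ⟨⟨v, hv, hv'⟩, ⟨w, hw, hw'⟩⟩ := hzn
      obtain ⟨t, rfl⟩ := (mem_sub_iff z v).1 hv
      obtain ⟨s, rfl⟩ := (mem_sub_iff z w).1 hw
      have aux : ∀ p : MvPolynomial ι K,
          IsPolyFn (fun x : Unit → K => MvPolynomial.eval (x () • z.rep) p) :=
        fun p => (isPolyFn_eval p).comp (φ := fun i x => x () * z.rep i)
          (fun i => ((isPolyFn_apply ()).mul (isPolyFn_const _)))
      obtain ⟨u, -, h1, h2⟩ := irr_univ.2 _ _ (aux p) (aux q) ⟨fun _ => t, trivial, hv'⟩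
        ⟨fun _ => s, trivial, hw'⟩
      refine h2 ?_
      rw [hq]
      refine hcon _ (mem_coneOf.2 ⟨z, hz, (mem_sub_iff z _).2 ⟨_, rfl⟩⟩) ?_
      rw [← hp]
      exact h1

lemma cone_closed {K : Type*} [Field K] {ι : Type*} {Z : Set (PP K ι)}
    (hZ : IsZClosed Z) (hZ0 : Z.Nonempty) (v : ι → K)
    (hv : ∀ p ∈ vI (coneOf Z), MvPolynomial.eval v p = 0) : v ∈ coneOf Z := by
  obtain ⟨S, -, rfl⟩ := hZ
  by_cases h0 : v = 0
  · obtain ⟨x, hx⟩ := hZ0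
    subst h0
    exact mem_coneOf.2 ⟨x, hx, Submodule.zero_mem _⟩
  · refine mem_coneOf.2 ⟨Projectivization.mk K v h0, ?_, ?_⟩
    · intro F hF w hw
      rw [Projectivization.submodule_mk, Submodule.mem_span_singleton] at hw
      obtain ⟨t, rfl⟩ := hw
      obtain ⟨g, hg⟩ : IsPolyFn (fun x : ι → K => MvPolynomial.eval (t • x) F) :=
        (isPolyFn_eval F).comp (φ := fun i x => t * x i)
          (fun i => (isPolyFn_const _).mul (isPolyFn_apply i))
      refine (hg v).symm.trans (hv g fun x hx => ?_)
      rw [hg]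
      have hx := cone_smul t x hx
      rw [mem_coneOf] at hx
      obtain ⟨y, hy, hx⟩ := hx
      exact hy F hF _ hx
    · rw [Projectivization.submodule_mk]
      exact Submodule.mem_span_singleton_self _

lemma cone_vI_lt {K : Type*} [Field K] {ι : Type*} {Z Z' : Set (PP K ι)}
    (hZ : IsZClosed Z) (hZ0 : Z.Nonempty) (hlt : Z < Z') :
    vI (coneOf Z') < vI (coneOf Z) := by
  refine lt_of_le_of_ne ?_ ?_
  · intro f hf x hx
    rw [mem_coneOf] at hx
    obtain ⟨y, hy, hx⟩ := hx
    exact hf x (mem_coneOf.2 ⟨y, hlt.le hy, hx⟩)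
  · intro heq
    refine not_le_of_gt hlt fun y hy => ?_
    have h1 : y.rep ∈ coneOf Z := cone_closed hZ hZ0 _ fun p hp => by
      rw [← heq] at hp
      exact hp _ (mem_coneOf.2 ⟨y, hy, rep_mem y⟩)
    have := mk_mem_of_cone h1 y.rep_nonzero
    rwa [y.mk_rep] at this

lemma cone_chain {K : Type*} [Field K] [Infinite K] {ι : Type*} {Y : Set (PP K ι)} {n : ℕ}
    (hY : IsIntegralVariety Y) (hYdim : zdim Y = ((n : ℕ∞) : WithBot ℕ∞)) :
    ∃ k, n + 1 ≤ k ∧ HasChain (coneOf Y) k := by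
  have hd : (n : WithBot ℕ∞) ≤ zdim Y := by rw [hYdim]; rfl
  rw [zdim, Order.le_krullDim_iff] at hd
  obtain ⟨l, hl⟩ := hd
  have key : ∀ k : ℕ, ∀ hk : k < l.length + 1,
      HasChain (coneOf (l ⟨k, hk⟩).1) (k + 1) := by
    intro k
    induction k with
    | zero =>
      intro hk
      have hirr0 : Irr ({0} : Set (ι → K)) := by
        refine ⟨⟨0, rfl⟩, ?_⟩
        rintro f g - - ⟨x, rfl, hx⟩ ⟨y, rfl, hy⟩
        exact ⟨0, rfl, hx, hy⟩
      have h0 : HasChain ({0} : Set (ι → K)) 0 :=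
        ⟨RelSeries.singleton _ ⟨vI {0}, hirr0.isPrime⟩, rfl, rfl⟩
      refine h0.step (cone_irr (l ⟨0, hk⟩).2.2.1) (lt_of_le_of_ne ?_ ?_)
      · rintro f hf _ rfl
        refine hf 0 ?_
        obtain ⟨x, hx⟩ := (l ⟨0, hk⟩).2.2.1.1
        exact mem_coneOf.2 ⟨x, hx, Submodule.zero_mem _⟩
      · intro heq
        obtain ⟨x, hx⟩ := (l ⟨0, hk⟩).2.2.1.1
        apply x.rep_nonzero
        funext i
        have : MvPolynomial.X i ∈ vI ({0} : Set (ι → K)) := by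
          rintro _ rfl; simp
        rw [← heq] at this
        simpa using this _ (mem_coneOf.2 ⟨x, hx, rep_mem x⟩)
    | succ k ih =>
      intro hk
      refine (ih (by omega)).step (cone_irr (l ⟨k + 1, hk⟩).2.2.1) ?_
      refine cone_vI_lt (l ⟨k, _⟩).2.1 (l ⟨k, _⟩).2.2.1.1 ?_
      exact l.step ⟨k, by omega⟩
  have h1 := key l.length (by omega)
  have hsub : (l ⟨l.length, by omega⟩).1 ⊆ Y :=
    (l ⟨l.length, by omega⟩).2.2.2.trans (Set.sInter_subset_of_mem ⟨hY.1, subset_rfl⟩)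
  subst hl
  rcases hsub.eq_or_ssubset with h | h
  · refine ⟨_, le_rfl, ?_⟩
    have aux : ∀ (Z : Set (PP K ι)) (m : ℕ), Z = Y → HasChain (coneOf Z) m →
        HasChain (coneOf Y) m := by
      rintro _ m rfl h; exact h
    exact aux _ _ h h1
  · refine ⟨l.length + 2, by omega, ?_⟩
    exact HasChain.step (E := coneOf (l ⟨l.length, by omega⟩).1) h1 (cone_irr hY.2)
      (cone_vI_lt (l ⟨l.length, by omega⟩).2.1 (l ⟨l.length, by omega⟩).2.2.1.1 h)

lemma chev2 {K : Type*} [Field K] [IsAlgClosed K] {σ τ α : Type*} [Finite σ] [Finite τ]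
    {X : Set (σ → K)} (hX : Irr X) (F : α → (σ → K) → (τ → K) → K)
    (hF : ∀ a, IsPolyFn (fun y : σ ⊕ τ → K => F a (fun s => y (Sum.inl s)) (fun t => y (Sum.inr t))))
    (G : (σ → K) → (τ → K) → K)
    (hG : IsPolyFn (fun y : σ ⊕ τ → K => G (fun s => y (Sum.inl s)) (fun t => y (Sum.inr t))))
    (hd : ∀ p : (σ → K) → K, IsPolyFn p → (∃ x ∈ X, p x ≠ 0) →
      ∃ x ∈ X, p x ≠ 0 ∧ ∃ z : τ → K, (∀ a, F a x z = 0) ∧ G x z ≠ 0) :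
    ∃ q : (σ → K) → K, IsPolyFn q ∧ (∃ x ∈ X, q x ≠ 0) ∧
      ∀ x ∈ X, q x ≠ 0 → ∃ z : τ → K, (∀ a, F a x z = 0) ∧ G x z ≠ 0 := by
  choose f hf using hF
  obtain ⟨g, hg⟩ := hG
  have hf' : ∀ a x z, MvPolynomial.eval (Sum.elim x z) (f a) = F a x z := fun a x z => hf a _
  have hg' : ∀ x z, MvPolynomial.eval (Sum.elim x z) g = G x z := fun x z => hg _
  obtain ⟨q, h1, h2⟩ := chev hX (Set.range f) g (by
    intro p hp
    obtain ⟨x, hx, hpx, z, h1, h2⟩ := hd _ (isPolyFn_eval p) hp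
    refine ⟨x, hx, hpx, z, ?_, ?_⟩
    · rintro _ ⟨a, rfl⟩
      rw [hf']; exact h1 a
    · rw [hg']; exact h2)
  refine ⟨_, isPolyFn_eval q, h1, fun x hx hq => ?_⟩
  obtain ⟨z, h3, h4⟩ := h2 x hx hq
  refine ⟨z, fun a => ?_, ?_⟩
  · rw [← hf']; exact h3 _ ⟨a, rfl⟩
  · rw [← hg']; exact h4

lemma irr_pi_set {K : Type*} [Field K] {κ σ : Type*} [Finite κ] {X : Set (σ → K)} (hX : Irr X) :
    Irr {z : κ × σ → K | ∀ i, (fun s => z (i, s)) ∈ X} := by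
  refine ⟨?_, ?_⟩
  · obtain ⟨x, hx⟩ := hX.1
    exact ⟨fun q => x q.2, fun _ => hx⟩
  · rintro f g hf hg ⟨x, hx, hfx⟩ ⟨y, hy, hgy⟩
    obtain ⟨z, hz, h1, h2⟩ := irr_pi (X := fun _ : κ => X) (fun _ => hX)
      (f := fun z => f (fun q => z q.1 q.2)) (g := fun z => g (fun q => z q.1 q.2)) hf hg
      ⟨fun i s => x (i, s), hx, hfx⟩ ⟨fun i s => y (i, s), hy, hgy⟩
    exact ⟨fun q => z q.1 q.2, hz, h1, h2⟩

lemma hyper_span {K : Type*} [Field K] {ι : Type*} [Fintype ι] {c : ℕ} (u : Fin c → PP K ι)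
    (y : PP K ι)
    (hy : ∀ f : ι → K, f ≠ 0 → (∀ i : Fin c, inHyperplane f (u i)) → inHyperplane f y) :
    y.rep ∈ Submodule.span K (Set.range fun i => (u i).rep) := by
  classical
  by_contra hn
  obtain ⟨φ, hφ, hle⟩ := Submodule.exists_le_ker_of_notMem hn
  have hrep : ∀ v : ι → K, ∑ i, φ (Pi.single i 1) * v i = φ v := by
    intro v
    conv_rhs => rw [← Finset.univ_sum_single v, map_sum]
    refine Finset.sum_congr rfl fun i _ => ?_
    have : Pi.single i (v i) = v i • (Pi.single i 1 : ι → K) := by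
      rw [← Pi.single_smul]; simp
    rw [this, map_smul, smul_eq_mul, mul_comm]
  have h1 := hy (fun i => φ (Pi.single i 1)) (by
    intro h0
    apply hφ
    rw [← hrep]
    exact Finset.sum_eq_zero fun i _ => by rw [congrFun h0 i]; simp) (by
    intro i
    rw [inHyperplane, hrep]
    exact hle (Submodule.subset_span ⟨i, rfl⟩))
  rw [inHyperplane, hrep] at h1
  exact hφ h1

lemma bad1 {K : Type*} [Field K] [Infinite K] {ι : Type*} [Fintype ι] {Y : Set (PP K ι)}
    {c : ℕ}
    (hbad : ¬ HoldsForGeneralTuples Y c fun u =>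
      {y | y ∈ Y ∧ ∀ f : ι → K, f ≠ 0 →
        (∀ i : Fin c, inHyperplane f (u i)) → inHyperplane f y} = Set.range u)
    {P : (Fin c → ι → K) → K} (hP : IsPolyFn2 P)
    (hP0 : ∃ u : Fin c → ι → K, (∀ i, u i ∈ coneOf Y) ∧ P u ≠ 0) :
    ∃ v : Fin c → ι → K, (∀ i, v i ∈ coneOf Y) ∧ P v ≠ 0 ∧ ∃ i j, i ≠ j ∧ ∃ a : Fin c → K,
      a i ≠ 0 ∧ a j ≠ 0 ∧ ∑ l, a l • v l ∈ coneOf Y := by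
  obtain ⟨p, hp⟩ := id hP
  have hp' : ∀ v : Fin c → ι → K, MvPolynomial.eval (fun q => v q.1 q.2) p = P v :=
    fun v => hp _
  have h1 : ∃ u : Fin c → PP K ι, (∀ i, u i ∈ Y) ∧
      (∃ v : Fin c → ι → K, (∀ i, v i ∈ (u i).submodule) ∧ P v ≠ 0) ∧
      ¬ ({y | y ∈ Y ∧ ∀ f : ι → K, f ≠ 0 →
        (∀ i : Fin c, inHyperplane f (u i)) → inHyperplane f y} = Set.range u) := by
    by_contra hcon
    apply hbad
    refine ⟨_, isMultiZClosed_of_poly p, ?_, ?_⟩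
    · obtain ⟨u, hu, hPu⟩ := hP0
      have : ∀ i, ∃ x ∈ Y, u i ∈ x.submodule := fun i => mem_coneOf.1 (hu i)
      choose x hx hux using this
      refine ⟨x, hx, fun hxT => hPu ?_⟩
      rw [← hp']
      exact hxT u hux
    · intro u hu huT
      by_contra hne
      refine hcon ⟨u, hu, ?_, hne⟩
      by_contra hc
      push Not at hc
      exact huT fun v hv => by rw [hp']; exact hc v hv
  obtain ⟨u, hu, ⟨v0, hv0, hPv0⟩, hne⟩ := h1
  have hrep : ∀ i, ∃ t : K, t • (u i).rep = v0 i := fun i => (mem_sub_iff _ _).1 (hv0 i)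
  choose t0 ht0 using hrep
  obtain ⟨t, -, hPt, htne⟩ := (irr_univ (K := K) (σ := Fin c)).2
    (fun t => P (fun i => t i • (u i).rep)) (fun t => ∏ i, t i)
    (hP.comp fun i s => (isPolyFn_apply i).mul (isPolyFn_const _))
    (IsPolyFn.prod _ fun i => isPolyFn_apply i)
    ⟨t0, trivial, by simpa only [ht0] using hPv0⟩ ⟨1, trivial, by simp⟩
  rw [Finset.prod_ne_zero_iff] at htne
  have htne : ∀ i, t i ≠ 0 := fun i => htne i (Finset.mem_univ i)
  have hex : ∃ y, (y ∈ Y ∧ ∀ f : ι → K, f ≠ 0 →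
      (∀ i : Fin c, inHyperplane f (u i)) → inHyperplane f y) ∧ y ∉ Set.range u := by
    by_contra hcon
    push Not at hcon
    refine hne (Set.Subset.antisymm (fun y hy => hcon y hy) ?_)
    rintro _ ⟨i, rfl⟩
    exact ⟨hu i, fun f _ h => h i⟩
  obtain ⟨y, ⟨hyY, hyH⟩, hyu⟩ := hex
  obtain ⟨b, hb⟩ := (Submodule.mem_span_range_iff_exists_fun K).1 (hyper_span u y hyH)
  have hy2 : ∑ l, (b l * (t l)⁻¹) • (t l • (u l).rep) = y.rep := by
    rw [← hb]
    refine Finset.sum_congr rfl fun l _ => ?_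
    rw [smul_smul, mul_assoc, inv_mul_cancel₀ (htne l), mul_one]
  refine ⟨fun i => t i • (u i).rep, fun i => cone_smul _ _ (mem_coneOf.2 ⟨u i, hu i, rep_mem _⟩),
    hPt, ?_⟩
  obtain ⟨i, hi⟩ : ∃ i, b i ≠ 0 := by
    by_contra hcon
    push Not at hcon
    apply y.rep_nonzero
    rw [← hb]
    exact Finset.sum_eq_zero fun i _ => by simp [hcon i]
  obtain ⟨j, hij, hj⟩ : ∃ j, i ≠ j ∧ b j ≠ 0 := by
    by_contra hcon
    push Not at hcon
    apply hyu
    refine ⟨i, ?_⟩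
    rw [Finset.sum_eq_single i (fun j _ hj => by simp [hcon j hj.symm]) (by simp)] at hb
    rw [← (u i).mk_rep, ← y.mk_rep]
    refine ((Projectivization.mk_eq_mk_iff' K _ _ y.rep_nonzero (u i).rep_nonzero).2 ⟨b i, hb⟩).symm
  refine ⟨i, j, hij, fun l => b l * (t l)⁻¹, mul_ne_zero hi (inv_ne_zero (htne i)),
    mul_ne_zero hj (inv_ne_zero (htne j)), ?_⟩
  rw [hy2]
  exact mem_coneOf.2 ⟨y, hyY, rep_mem y⟩

lemma bad2 {K : Type*} [Field K] [IsAlgClosed K] {ι : Type*} [Fintype ι] {Y : Set (PP K ι)}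
    (hY : IsIntegralVariety Y) {c : ℕ}
    (hbad : ¬ HoldsForGeneralTuples Y c fun u =>
      {y | y ∈ Y ∧ ∀ f : ι → K, f ≠ 0 →
        (∀ i : Fin c, inHyperplane f (u i)) → inHyperplane f y} = Set.range u) :
    ∃ i j : Fin c, i ≠ j ∧ ∃ q : (Fin c → ι → K) → K, IsPolyFn2 q ∧
      (∃ u : Fin c → ι → K, (∀ i, u i ∈ coneOf Y) ∧ q u ≠ 0) ∧
      ∀ u : Fin c → ι → K, (∀ i, u i ∈ coneOf Y) → q u ≠ 0 → ∃ a : Fin c → K,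
        a i ≠ 0 ∧ a j ≠ 0 ∧ ∑ l, a l • u l ∈ coneOf Y := by
  have : Infinite K := IsAlgClosed.instInfinite
  have hC := cone_irr hY.2
  have hX := irr_pi_set (κ := Fin c) hC
  have hcl := cone_closed hY.1 hY.2.1
  have hdense : ∃ i j : Fin c, i ≠ j ∧ ∀ P : (Fin c × ι → K) → K, IsPolyFn P →
      (∃ z ∈ {z : Fin c × ι → K | ∀ i, (fun s => z (i, s)) ∈ coneOf Y}, P z ≠ 0) →
      ∃ z ∈ {z : Fin c × ι → K | ∀ i, (fun s => z (i, s)) ∈ coneOf Y}, P z ≠ 0 ∧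
        ∃ a : Fin c → K, a i ≠ 0 ∧ a j ≠ 0 ∧ ∑ l, a l • (fun s => z (l, s)) ∈ coneOf Y := by
    by_contra hcon
    push Not at hcon
    have hcon' : ∀ ij : Fin c × Fin c, ∃ P : (Fin c × ι → K) → K, IsPolyFn P ∧
        (∃ z ∈ {z : Fin c × ι → K | ∀ i, (fun s => z (i, s)) ∈ coneOf Y}, P z ≠ 0) ∧
        (ij.1 ≠ ij.2 → ∀ z ∈ {z : Fin c × ι → K | ∀ i, (fun s => z (i, s)) ∈ coneOf Y}, P z ≠ 0 →
        ∀ a : Fin c → K, a ij.1 ≠ 0 → a ij.2 ≠ 0 →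
          ∑ l, a l • (fun s => z (l, s)) ∉ coneOf Y) := by
      rintro ⟨i, j⟩
      by_cases h : i = j
      · obtain ⟨z, hz⟩ := hX.1
        exact ⟨fun _ => 1, isPolyFn_const 1, ⟨z, hz, one_ne_zero⟩, fun h' => absurd h h'⟩
      · obtain ⟨P, h1, h2, h3⟩ := hcon i j h
        exact ⟨P, h1, h2, fun _ => h3⟩
    choose P hP1 hP2 hP3 using hcon'
    obtain ⟨z, hz, hzP⟩ := hX.prod Finset.univ P hP1 hP2
    obtain ⟨v, hv, hPv, i, j, hij, a, hai, haj, hs⟩ := bad1 hbad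
      (P := fun v => ∏ ij, P ij (fun q => v q.1 q.2)) (IsPolyFn.prod Finset.univ hP1)
      ⟨fun i s => z (i, s), hz, Finset.prod_ne_zero_iff.2 hzP⟩
    exact hP3 (i, j) hij (fun q => v q.1 q.2) hv
      (Finset.prod_ne_zero_iff.1 hPv (i, j) (Finset.mem_univ _)) a hai haj hs
  obtain ⟨i, j, hij, hd⟩ := hdense
  obtain ⟨q, hq, ⟨z, hz, hqz⟩, hq2⟩ := chev2 hX (τ := Fin c) (α := vI (coneOf Y))
    (fun p z a => MvPolynomial.eval (∑ l, a l • (fun s => z (l, s))) p.1)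
    (by
      intro p
      have : ∀ (y : Fin c × ι ⊕ Fin c → K), (∑ l, y (Sum.inr l) • fun s => y (Sum.inl (l, s)))
          = fun s => ∑ l, y (Sum.inr l) * y (Sum.inl (l, s)) := by
        intro y; funext s; simp
      simp only [this]
      exact (isPolyFn_eval p.1).comp fun s => IsPolyFn.sum _ fun l =>
        (isPolyFn_apply _).mul (isPolyFn_apply _))
    (fun z a => a i * a j)
    ((isPolyFn_apply _).mul (isPolyFn_apply _))
    (by
      intro P hP hP0
      obtain ⟨z, hz, hPz, a, hai, haj, hs⟩ := hd P hP hP0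
      exact ⟨z, hz, hPz, a, fun p => p.2 _ hs, mul_ne_zero hai haj⟩)
  refine ⟨i, j, hij, fun u => q (fun p => u p.1 p.2), hq, ⟨fun i s => z (i, s), hz, hqz⟩, ?_⟩
  intro u hu hqu
  obtain ⟨a, h1, h2⟩ := hq2 (fun p => u p.1 p.2) hu hqu
  exact ⟨a, left_ne_zero_of_mul h2, right_ne_zero_of_mul h2, hcl _ fun p hp => h1 ⟨p, hp⟩⟩

lemma exists_det {K : Type*} [Field K] {ι : Type*} [Fintype ι] [DecidableEq ι] {C : Set (ι → K)}
    (hC : Submodule.span K C = ⊤) :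
    ∃ w : ι → ι → K, (∀ i, w i ∈ C) ∧ (Matrix.of w).det ≠ 0 := by
  obtain ⟨b, hb, hsp, hli⟩ := exists_linearIndependent K C
  have hB : ⊤ ≤ Submodule.span K (Set.range (Subtype.val : b → ι → K)) := by
    rw [Subtype.range_coe, hsp, hC]
  let B := Module.Basis.mk hli hB
  let e : ι ≃ b := (Pi.basisFun K ι).indexEquiv B
  refine ⟨fun i => (e i).1, fun i => hb (e i).2, ?_⟩
  rw [← isUnit_iff_ne_zero, ← Matrix.isUnit_iff_isUnit_det, ← Matrix.linearIndependent_rows_iff_isUnit]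
  exact hli.comp e e.injective

lemma vs_points {K : Type*} [Field K] {ι : Type*} [Fintype ι] [DecidableEq ι]
    (w : ι → ι → K) (hw : LinearIndependent K w) (J : Finset ι) (A A' : ι → K)
    (hA : ∀ i, i ∉ J → A i = 0) (hA' : ∀ i, i ∉ J → A' i = 0)
    (h2 : ∃ i j, i ≠ j ∧ A i ≠ 0 ∧ A j ≠ 0) (h2' : ∃ i j, i ≠ j ∧ A' i ≠ 0 ∧ A' j ≠ 0)
    (h3 : ∃ i, A i ≠ 0 ∧ A' i = 0) :
    ∃ F : Finset (PP K ι), F.card = J.card + 2 ∧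
      Module.finrank K (vspan (F : Set (PP K ι))) ≤ J.card ∧
      ∀ x ∈ F, ∃ (v : ι → K) (hv : v ≠ 0), x = Projectivization.mk K v hv ∧
        ((∃ i ∈ J, v = w i) ∨ v = ∑ i, A i • w i ∨ v = ∑ i, A' i • w i) := by
  classical
  have hinj : ∀ a b : ι → K, ∑ i, a i • w i = ∑ i, b i • w i → a = b := by
    intro a b hab
    have := Fintype.linearIndependent_iff.1 hw (fun i => a i - b i) (by
      simp only [sub_smul, Finset.sum_sub_distrib, hab, sub_self])
    funext i
    exact sub_eq_zero.1 (this i)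
  have hinj2 : ∀ (t : K) (a b : ι → K), t • ∑ i, a i • w i = ∑ i, b i • w i →
      ∀ i, t * a i = b i := by
    intro t a b h i
    have := hinj (t • a) b (by rw [← h, Finset.smul_sum]; simp [smul_smul])
    exact congrFun this i
  have hw1 : ∀ i, w i = ∑ j, (Pi.single i 1 : ι → K) j • w j := by
    intro i
    simp [Pi.single_apply]
  have hne0 : ∀ a : ι → K, (∃ i, a i ≠ 0) → ∑ i, a i • w i ≠ 0 := by
    rintro a ⟨i, hi⟩ h0
    exact hi (Fintype.linearIndependent_iff.1 hw a h0 i)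
  obtain ⟨p, q, hpq, hp, hq⟩ := h2
  obtain ⟨p', q', hpq', hp', hq'⟩ := h2'
  obtain ⟨s, hs, hs'⟩ := h3
  have hA0 := hne0 A ⟨p, hp⟩
  have hA0' := hne0 A' ⟨p', hp'⟩
  let f : ι → PP K ι := fun i => Projectivization.mk K (w i) (hw.ne_zero i)
  have hf : Function.Injective f := by
    intro i j hij
    obtain ⟨t, ht⟩ := (Projectivization.mk_eq_mk_iff' K _ _ (hw.ne_zero i) (hw.ne_zero j)).1 hij
    rw [hw1 i, hw1 j] at ht
    have := hinj2 _ _ _ ht i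
    by_contra hne
    simp [Pi.single_apply, hne] at this
  have aux : ∀ (B : ι → K) (hB0 : ∑ i, B i • w i ≠ 0) (p q : ι), p ≠ q → B p ≠ 0 → B q ≠ 0 →
      Projectivization.mk K _ hB0 ∉ J.image f := by
    intro B hB0 p q hpq hp hq hmem
    obtain ⟨i, -, hi⟩ := Finset.mem_image.1 hmem
    obtain ⟨t, ht⟩ := (Projectivization.mk_eq_mk_iff' K _ _ hB0 (hw.ne_zero i)).1 hi.symm
    rw [hw1 i] at ht
    have e1 := hinj2 _ _ _ ht p
    have e2 := hinj2 _ _ _ ht q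
    by_cases h : p = i
    · subst h
      simp [Pi.single_apply, hpq.symm] at e2
      exact hq e2.symm
    · simp [Pi.single_apply, h] at e1
      exact hp e1.symm
  have hAA : Projectivization.mk K _ hA0 ∉ insert (Projectivization.mk K _ hA0') (J.image f) := by
    rw [Finset.mem_insert, not_or]
    refine ⟨?_, aux A hA0 p q hpq hp hq⟩
    intro h
    obtain ⟨t, ht⟩ := (Projectivization.mk_eq_mk_iff' K _ _ hA0 hA0').1 h
    have := hinj2 _ _ _ ht s
    rw [hs', mul_zero] at this
    exact hs this.symm
  have hmem : ∀ x ∈ insert (Projectivization.mk K _ hA0)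
      (insert (Projectivization.mk K _ hA0') (J.image f)),
      ∃ (v : ι → K) (hv : v ≠ 0), x = Projectivization.mk K v hv ∧
        ((∃ i ∈ J, v = w i) ∨ v = ∑ i, A i • w i ∨ v = ∑ i, A' i • w i) := by
    intro x hx
    simp only [Finset.mem_insert, Finset.mem_image] at hx
    rcases hx with rfl | rfl | ⟨i, hi, rfl⟩
    · exact ⟨_, hA0, rfl, Or.inr (Or.inl rfl)⟩
    · exact ⟨_, hA0', rfl, Or.inr (Or.inr rfl)⟩
    · exact ⟨_, hw.ne_zero i, rfl, Or.inl ⟨i, hi, rfl⟩⟩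
  refine ⟨insert (Projectivization.mk K _ hA0)
    (insert (Projectivization.mk K _ hA0') (J.image f)), ?_, ?_, hmem⟩
  · rw [Finset.card_insert_of_notMem hAA, Finset.card_insert_of_notMem
      (aux A' hA0' p' q' hpq' hp' hq'), Finset.card_image_of_injective _ hf]
  · have hsum : ∀ B : ι → K, (∀ i, i ∉ J → B i = 0) →
        ∑ i, B i • w i ∈ Submodule.span K ((J.image w : Finset (ι → K)) : Set (ι → K)) := by
      intro B hB
      refine Submodule.sum_mem _ fun i _ => ?_
      by_cases hi : i ∈ J
      · refine Submodule.smul_mem _ _ (Submodule.subset_span ?_)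
        simpa using ⟨i, hi, rfl⟩
      · rw [hB i hi, zero_smul]; exact Submodule.zero_mem _
    have hle : vspan ((insert (Projectivization.mk K _ hA0)
        (insert (Projectivization.mk K _ hA0') (J.image f)) : Finset (PP K ι)) : Set (PP K ι)) ≤
        Submodule.span K ((J.image w : Finset (ι → K)) : Set (ι → K)) := by
      rw [vspan, Submodule.span_le]
      intro z hz
      obtain ⟨x, hx, hz⟩ := mem_coneOf.1 hz
      obtain ⟨v, hv, rfl, hor⟩ := hmem x (Finset.mem_coe.1 hx)
      rw [Projectivization.submodule_mk, Submodule.mem_span_singleton] at hz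
      obtain ⟨t, rfl⟩ := hz
      refine Submodule.smul_mem _ _ ?_
      rcases hor with ⟨i, hi, rfl⟩ | rfl | rfl
      · refine Submodule.subset_span ?_
        simpa using ⟨i, hi, rfl⟩
      · exact hsum A hA
      · exact hsum A' hA'
    exact (Submodule.finrank_mono hle).trans
      ((finrank_span_finset_le_card _).trans Finset.card_image_le)

lemma extend_sum {K : Type*} [Field K] {ι : Type*} [Fintype ι] {c : ℕ} (ε : Fin c → ι)
    (hε : Function.Injective ε) (w : ι → ι → K) (a : Fin c → K) :
    ∑ i, Function.extend ε a 0 i • w i = ∑ l, a l • w (ε l) := by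
  classical
  rw [← Finset.sum_subset (Finset.subset_univ (Finset.univ.image ε))]
  · rw [Finset.sum_image (fun x _ y _ h => hε h)]
    exact Finset.sum_congr rfl fun l _ => by rw [hε.extend_apply]
  · intro i _ hi
    rw [Function.extend_apply', Pi.zero_apply, zero_smul]
    rintro ⟨l, rfl⟩
    exact hi (Finset.mem_image_of_mem _ (Finset.mem_univ _))

lemma conclude {K : Type*} [Field K] [IsAlgClosed K]
    {ι : Type*} [Fintype ι] (r n : ℕ) (hι : Fintype.card ι = r + 1)
    (Y : Set (PP K ι)) (hY : IsIntegralVariety Y) (hYnd : Nondegenerate Y)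
    (hYdim : zdim Y = ((n : ℕ∞) : WithBot ℕ∞))
    (c : ℕ) (hc : c ≤ r - n - 1) (i₀ j₀ : Fin c) (hij : i₀ ≠ j₀) (q : (Fin c → ι → K) → K)
    (hq : IsPolyFn2 q) (hq0 : ∃ u : Fin c → ι → K, (∀ i, u i ∈ coneOf Y) ∧ q u ≠ 0)
    (hqa : ∀ u : Fin c → ι → K, (∀ i, u i ∈ coneOf Y) → q u ≠ 0 → ∃ a : Fin c → K,
        a i₀ ≠ 0 ∧ a j₀ ≠ 0 ∧ ∑ l, a l • u l ∈ coneOf Y) : VeryStrange n Y := by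
  classical
  have : Infinite K := IsAlgClosed.instInfinite
  have hC := cone_irr hY.2
  have hcl := cone_closed hY.1 hY.2.1
  obtain ⟨k, hk, hchain⟩ := cone_chain hY hYdim
  have hspan : Submodule.span K (coneOf Y) = ⊤ := hYnd
  have hcpos : 0 < c := i₀.pos
  obtain ⟨J0, -, hJ0⟩ := Finset.exists_subset_card_eq (s := (Finset.univ : Finset ι))
    (n := r + 1 - n) (by rw [Finset.card_univ, hι]; omega)
  obtain ⟨J1, hJ10, hJ1⟩ := Finset.exists_subset_card_eq (s := J0)
    (n := r - n) (by rw [hJ0]; omega)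
  have hJc : (J0ᶜ).card = n := by
    rw [Finset.card_compl, hJ0, hι]; omega
  let eN : Fin n → ι := fun j => ((J0ᶜ).equivFinOfCardEq hJc).symm j
  have heN : Function.Injective eN :=
    Subtype.val_injective.comp ((J0ᶜ).equivFinOfCardEq hJc).symm.injective
  have heN' : ∀ j, eN j ∉ J0 := fun j =>
    Finset.mem_compl.1 (((J0ᶜ).equivFinOfCardEq hJc).symm j).2
  obtain ⟨ε⟩ : Nonempty (Fin (c + 1) ↪ J1) := Function.Embedding.nonempty_of_card_le (by
    rw [Fintype.card_fin, Fintype.card_coe, hJ1]; omega)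
  let ε0 : Fin c → ι := fun l => (ε l.castSucc).1
  let ε1 : Fin c → ι := fun l => if l = i₀ then (ε (Fin.last c)).1 else (ε l.castSucc).1
  have hε0 : Function.Injective ε0 := by
    intro a b hab
    exact Fin.castSucc_injective _ (ε.injective (Subtype.val_injective hab))
  have hlast : ∀ l : Fin c, (ε (Fin.last c)).1 ≠ (ε l.castSucc).1 := by
    intro l h
    exact (Fin.castSucc_lt_last l).ne (ε.injective (Subtype.val_injective h)).symm
  have hε1 : Function.Injective ε1 := by
    intro a b hab
    simp only [ε1] at hab
    split_ifs at hab with h1 h2 h2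
    · rw [h1, h2]
    · exact absurd hab (hlast b)
    · exact absurd hab.symm (hlast a)
    · exact hε0 hab
  have hε0J : ∀ l, ε0 l ∈ J1 := fun l => (ε l.castSucc).2
  have hε1J : ∀ l, ε1 l ∈ J1 := by
    intro l
    simp only [ε1]
    split_ifs
    · exact (ε _).2
    · exact (ε _).2
  have hε01 : ∀ l, ε1 l ≠ ε0 i₀ := by
    intro l
    simp only [ε1, ε0]
    split_ifs with h
    · exact hlast i₀
    · intro h'
      exact h (hε0 h')
  -- the big polynomial
  have hext : ∀ ε : Fin c → ι, Function.Injective ε →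
      ∃ w : ι → ι → K, (∀ i, w i ∈ coneOf Y) ∧ q (fun l => w (ε l)) ≠ 0 := by
    intro ε hε
    obtain ⟨u, hu, hqu⟩ := hq0
    obtain ⟨c0, hc0⟩ := hC.1
    refine ⟨Function.extend ε u (fun _ => c0), fun i => ?_, ?_⟩
    · by_cases h : ∃ l, ε l = i
      · obtain ⟨l, rfl⟩ := h
        rw [hε.extend_apply]; exact hu l
      · rw [Function.extend_apply' _ _ _ h]; exact hc0
    · simpa only [hε.extend_apply] using hqu
  have hqe : ∀ ε : Fin c → ι, IsPolyFn2 (fun w : ι → ι → K => q (fun l => w (ε l))) :=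
    fun ε => hq.comp2 fun l s => isPolyFn2_apply _ _
  have hdet : IsPolyFn2 (fun w : ι → ι → K => (Matrix.of w).det) :=
    IsPolyFn.det fun i j => isPolyFn_apply (i, j)
  let G : (ι → ι → K) → K := fun w =>
    (q (fun l => w (ε0 l)) * q (fun l => w (ε1 l))) * (Matrix.of w).det
  have hG : IsPolyFn2 G := ((hqe ε0).mul (hqe ε1)).mul hdet
  have hG0 : ∃ w : ι → ι → K, (∀ i, w i ∈ coneOf Y) ∧ G w ≠ 0 := by
    obtain ⟨w, hw, h1, h2⟩ := irr_pi (X := fun _ : ι => coneOf Y) (fun _ => hC) (hqe ε0) (hqe ε1)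
      (hext ε0 hε0) (hext ε1 hε1)
    obtain ⟨w, hw, h1, h2⟩ := irr_pi (X := fun _ : ι => coneOf Y) (fun _ => hC)
      ((hqe ε0).mul (hqe ε1)) hdet ⟨w, hw, mul_ne_zero h1 h2⟩ (exists_det hspan)
    exact ⟨w, hw, mul_ne_zero h1 h2⟩
  obtain ⟨Q, hQ, ⟨h0, -, hQ0⟩, hQ2⟩ := chev2 (K := K) (irr_univ (σ := Fin n × ι)) (τ := ι × ι)
    (α := (vI (coneOf Y) × ι) ⊕ (Fin n × J0))
    (fun a h w => Sum.elim
      (fun pi : vI (coneOf Y) × ι => MvPolynomial.eval (fun s => w (pi.2, s)) pi.1.1)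
      (fun ji : Fin n × J0 => ∑ l, h (ji.1, l) * w (ji.2.1, l)) a)
    (by
      rintro (⟨p, i⟩ | ⟨j, i⟩)
      · exact (isPolyFn_eval p.1).comp fun s => isPolyFn_apply _
      · exact IsPolyFn.sum _ fun l => (isPolyFn_apply _).mul (isPolyFn_apply _))
    (fun h w => G (fun i s => w (i, s)))
    (hG.comp fun i s => isPolyFn_apply (Sum.inr (i, s)))
    (by
      intro p hp hp0
      obtain ⟨h0, -, hh0⟩ := hp0
      obtain ⟨h, hh, w, hw, hGw, hlin⟩ := dom hC (fun t e he => cone_smul t e he) hspan hchain J0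
        (by rw [hι, hJ0]; omega) eN heN heN' hG hG0
        (p := fun h : Fin n → ι → K => p (fun z => h z.1 z.2)) hp
        ⟨fun j s => h0 (j, s), hh0⟩
      refine ⟨fun z => h z.1 z.2, trivial, hh, fun z => w z.1 z.2, ?_, hGw⟩
      rintro (⟨p, i⟩ | ⟨j, i⟩)
      · exact p.2 _ (hw i)
      · exact hlin j i.1 i.2)
  obtain ⟨Q', hQ'⟩ := hQ
  refine ⟨{h | ∀ f ∈ ({Q'} : Set (MvPolynomial (Fin n × ι) K)),
    MvPolynomial.eval (fun p => h p.1 p.2) f = 0}, ⟨_, rfl⟩, ⟨fun j s => h0 (j, s), ?_⟩, ?_⟩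
  · intro hmem
    have := hmem Q' rfl
    rw [hQ'] at this
    exact hQ0 this
  intro h hh
  have hQh : Q (fun p => h p.1 p.2) ≠ 0 := by
    intro h0
    apply hh
    rintro _ rfl
    rw [hQ', h0]
  obtain ⟨z, hz, hGz⟩ := hQ2 _ trivial hQh
  obtain ⟨w, rfl⟩ : ∃ w : ι → ι → K, z = fun p => w p.1 p.2 := ⟨fun i s => z (i, s), rfl⟩
  have hwC : ∀ i, w i ∈ coneOf Y := fun i => hcl _ fun p hp => hz (Sum.inl (⟨p, hp⟩, i))
  have hwh : ∀ j, ∀ i ∈ J0, ∑ l, h j l * w i l = 0 := fun j i hi => hz (Sum.inr (j, ⟨i, hi⟩))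
  have hGw : G w ≠ 0 := hGz
  have hli : LinearIndependent K w := by
    have h1 : (Matrix.of w).det ≠ 0 := right_ne_zero_of_mul hGw
    rw [← isUnit_iff_ne_zero, ← Matrix.isUnit_iff_isUnit_det,
      ← Matrix.linearIndependent_rows_iff_isUnit] at h1
    exact h1
  obtain ⟨a, hai, haj, hay⟩ := hqa (fun l => w (ε0 l)) (fun l => hwC _)
    (left_ne_zero_of_mul (left_ne_zero_of_mul hGw))
  obtain ⟨b, hbi, hbj, hby⟩ := hqa (fun l => w (ε1 l)) (fun l => hwC _)
    (right_ne_zero_of_mul (left_ne_zero_of_mul hGw))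
  have hsupp : ∀ (ε : Fin c → ι), (∀ l, ε l ∈ J1) → ∀ a : Fin c → K, ∀ i, i ∉ J1 →
      Function.extend ε a 0 i = 0 := by
    intro ε hε a i hi
    rw [Function.extend_apply', Pi.zero_apply]
    rintro ⟨l, rfl⟩
    exact hi (hε l)
  obtain ⟨F, hF1, hF2, hF3⟩ := vs_points w hli J1 (Function.extend ε0 a 0) (Function.extend ε1 b 0)
    (hsupp ε0 hε0J a) (hsupp ε1 hε1J b)
    ⟨ε0 i₀, ε0 j₀, hε0.ne hij, by rwa [hε0.extend_apply], by rwa [hε0.extend_apply]⟩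
    ⟨ε1 i₀, ε1 j₀, hε1.ne hij, by rwa [hε1.extend_apply], by rwa [hε1.extend_apply]⟩
    ⟨ε0 i₀, by rwa [hε0.extend_apply], by
      rw [Function.extend_apply', Pi.zero_apply]
      rintro ⟨l, hl⟩
      exact hε01 l hl⟩
  rw [extend_sum ε0 hε0, extend_sum ε1 hε1] at hF3
  refine ⟨F, ?_, by rw [hF1, hJ1, hι]; omega, hF2.trans (by rw [hJ1, hι]; omega)⟩
  have hsl : ∀ (v : ι → K) (hv : v ≠ 0), v ∈ coneOf Y → (∀ j, ∑ l, h j l * v l = 0) →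
      Projectivization.mk K v hv ∈ Y ∩ linearSlice h := by
    intro v hv hvC hvh
    refine ⟨mk_mem_of_cone hvC hv, fun j => ?_⟩
    obtain ⟨t, ht⟩ := Projectivization.exists_smul_eq_mk_rep K v hv
    rw [← ht]
    have : ∑ i, h j i * (t • v) i = (t : K) * ∑ i, h j i * v i := by
      rw [Finset.mul_sum]
      refine Finset.sum_congr rfl fun i _ => ?_
      rw [Units.smul_def, Pi.smul_apply, smul_eq_mul]
      ring
    rw [this, hvh, mul_zero]
  have hcomb : ∀ (ε : Fin c → ι), (∀ l, ε l ∈ J1) → ∀ a : Fin c → K, ∀ j,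
      ∑ s, h j s * (∑ l, a l • w (ε l)) s = 0 := by
    intro ε hε a j
    have : ∀ s, h j s * (∑ l, a l • w (ε l)) s = ∑ l, a l * (h j s * w (ε l) s) := by
      intro s
      rw [Finset.sum_apply, Finset.mul_sum]
      refine Finset.sum_congr rfl fun l _ => ?_
      rw [Pi.smul_apply, smul_eq_mul]
      ring
    simp only [this]
    rw [Finset.sum_comm]
    refine Finset.sum_eq_zero fun l _ => ?_
    rw [← Finset.mul_sum, hwh j _ (hJ10 (hε l)), mul_zero]
  intro x hx
  obtain ⟨v, hv, rfl, hor⟩ := hF3 x hx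
  rcases hor with ⟨i, hi, rfl⟩ | rfl | rfl
  · exact hsl _ hv (hwC i) fun j => hwh j i (hJ10 hi)
  · exact hsl _ hv hay (hcomb ε0 hε0J a)
  · exact hsl _ hv hby (hcomb ε1 hε1J b)

/-- **Lemma (a10).**  Let `Y ⊆ ℙ^r` be an integral non-degenerate variety of
dimension `n` over an algebraically closed field of arbitrary characteristic, not
very strange.  Fix a general subset `S ⊆ Y` with `#S = c ≤ r - n - 1`.  Then `S` is
the set-theoretic base locus of the linear system on `Y` induced by the hyperplanes
through `S`: the only points of `Y` lying on every hyperplane containing `S` are the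
points of `S`. -/
theorem statement17 {K : Type*} [Field K] [IsAlgClosed K]
    {ι : Type*} [Fintype ι] (r n : ℕ) (hι : Fintype.card ι = r + 1)
    (Y : Set (PP K ι)) (hY : IsIntegralVariety Y) (hYnd : Nondegenerate Y)
    (hYdim : zdim Y = ((n : ℕ∞) : WithBot ℕ∞))
    (hvs : ¬VeryStrange n Y)
    (c : ℕ) (hc : c ≤ r - n - 1) :
    HoldsForGeneralTuples Y c fun u =>
      {y | y ∈ Y ∧ ∀ f : ι → K, f ≠ 0 →
        (∀ i : Fin c, inHyperplane f (u i)) → inHyperplane f y} = Set.range u := by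
  by_contra hbad
  obtain ⟨i, j, hij, q, hq, hq0, hqa⟩ := bad2 hY hbad
  exact hvs (conclude r n hι Y hY hYnd hYdim c hc i j hij q hq hq0 hqa)

end ContactLoci
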